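/- arXiv:math/0311012 — 2 statements merged into one kernel-verified Lean document; each statement's English description precedes it below -/
import Mathlib

section
/- Let V be a finite-dimensional vector space over a field K of characteristic 0 and let W ≤ GL(V) be a finite group. Then the ring of invariants K[V]^W is a polynomial ring if and only if W is generated by (pseudo-)reflections. -/
open MvPolynomial

variable {K : Type*} [Field K] {n : ℕ}

/-- A (pseudo-)reflection: a non-trivial element of `GL(V)` of finite order
which fixes a hyperplane (a subspace of codimension one) pointwise. -/
def IsPseudoReflection (g : (Fin n → K) ≃ₗ[K] (Fin n → K)) : Prop :=
  g ≠ 1 ∧ IsOfFinOrder g ∧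
    ∃ H : Submodule K (Fin n → K),
      Module.finrank K H + 1 = n ∧ ∀ v ∈ H, g v = v

/-- The matrix of a linear automorphism of `Fin n → K` in the standard basis. -/
noncomputable def glMatrix (g : (Fin n → K) ≃ₗ[K] (Fin n → K)) :
    Matrix (Fin n) (Fin n) K :=
  LinearMap.toMatrix (Pi.basisFun K (Fin n)) (Pi.basisFun K (Fin n)) g.toLinearMap

/-- The induced action of a linear automorphism on the algebra
`K[V] = K[X_1, ..., X_n]` of polynomial functions on `V`. -/
noncomputable def polyAct (g : (Fin n → K) ≃ₗ[K] (Fin n → K)) :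
    MvPolynomial (Fin n) K →ₐ[K] MvPolynomial (Fin n) K :=
  MvPolynomial.aeval fun i => ∑ j, MvPolynomial.C (glMatrix g i j) * MvPolynomial.X j

/-- The subalgebra `K[V]^W` of `W`-invariant polynomial functions. -/
noncomputable def invariantsAlg (W : Subgroup ((Fin n → K) ≃ₗ[K] (Fin n → K))) :
    Subalgebra K (MvPolynomial (Fin n) K) where
  carrier := {p | ∀ g ∈ W, polyAct g p = p}
  mul_mem' := by
    intro a b ha hb g hg
    simp only [map_mul, ha g hg, hb g hg]
  add_mem' := by
    intro a b ha hb g hg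
    simp only [map_add, ha g hg, hb g hg]
  algebraMap_mem' := by
    intro r g hg
    simp [polyAct]

/-- A `K`-subalgebra is a polynomial ring if it is isomorphic, as a `K`-algebra,
to a polynomial ring in finitely many variables. -/
def IsPolynomialRing {R : Type*} [CommRing R] [Algebra K R] (A : Subalgebra K R) : Prop :=
  ∃ m : ℕ, Nonempty (MvPolynomial (Fin m) K ≃ₐ[K] A)

section Action

lemma polyAct_X (g : (Fin n → K) ≃ₗ[K] (Fin n → K)) (i : Fin n) :
    polyAct g (X i) = ∑ j, C (glMatrix g i j) * X j := by
  simp [polyAct]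

lemma glMatrix_mul (g h : (Fin n → K) ≃ₗ[K] (Fin n → K)) :
    glMatrix (g * h) = glMatrix g * glMatrix h :=
  LinearMap.toMatrix_comp _ (Pi.basisFun K (Fin n)) _ g.toLinearMap h.toLinearMap

lemma glMatrix_one : glMatrix (1 : (Fin n → K) ≃ₗ[K] (Fin n → K)) = 1 :=
  LinearMap.toMatrix_id _

lemma glMatrix_mulVec (g : (Fin n → K) ≃ₗ[K] (Fin n → K)) (v : Fin n → K) :
    (glMatrix g).mulVec v = g v := by
  simp [glMatrix]

/-- The action on polynomial functions is contravariant. -/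
lemma polyAct_polyAct (g h : (Fin n → K) ≃ₗ[K] (Fin n → K)) (p : MvPolynomial (Fin n) K) :
    polyAct h (polyAct g p) = polyAct (g * h) p := by
  have : (polyAct h).comp (polyAct g) = polyAct (g * h) := by
    refine MvPolynomial.algHom_ext fun i => ?_
    simp only [AlgHom.comp_apply, polyAct_X, map_sum, map_mul, glMatrix_mul, Matrix.mul_apply,
      Finset.sum_mul, Finset.mul_sum, MvPolynomial.algHom_C, MvPolynomial.algebraMap_eq]
    rw [Finset.sum_comm]
    simp only [mul_assoc]
  exact DFunLike.congr_fun this p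

lemma polyAct_one (p : MvPolynomial (Fin n) K) : polyAct 1 p = p := by
  have : polyAct (1 : (Fin n → K) ≃ₗ[K] (Fin n → K)) = AlgHom.id K _ := by
    refine MvPolynomial.algHom_ext fun i => ?_
    simp [polyAct_X, glMatrix_one, Matrix.one_apply]
  exact DFunLike.congr_fun this p

lemma polyAct_inv_polyAct (g : (Fin n → K) ≃ₗ[K] (Fin n → K)) (p : MvPolynomial (Fin n) K) :
    polyAct g⁻¹ (polyAct g p) = p := by
  rw [polyAct_polyAct, mul_inv_cancel, polyAct_one]

lemma polyAct_isHomogeneous (g : (Fin n → K) ≃ₗ[K] (Fin n → K)) {p : MvPolynomial (Fin n) K}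
    {d : ℕ} (hp : p.IsHomogeneous d) : (polyAct g p).IsHomogeneous d := by
  have := hp.aeval (fun i => ∑ j, C (glMatrix g i j) * X j) (n := 1) fun i =>
    IsHomogeneous.sum _ _ _ fun j _ => isHomogeneous_C_mul_X _ _
  rwa [one_mul] at this

lemma homogeneousComponent_sum_of_isHomogeneous {σ : Type*} {R : Type*} [CommSemiring R]
    (f : ℕ → MvPolynomial σ R) (hf : ∀ i, (f i).IsHomogeneous i) (N d : ℕ)
    (hN : N ≤ d → f d = 0) :
    homogeneousComponent d (∑ i ∈ Finset.range N, f i) = f d := by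
  classical
  rw [map_sum, Finset.sum_congr rfl fun i _ => homogeneousComponent_of_mem (hf i)]
  rw [Finset.sum_ite_eq]
  split_ifs with h
  · rfl
  · exact (hN (by simpa using h)).symm

lemma polyAct_homogeneousComponent (g : (Fin n → K) ≃ₗ[K] (Fin n → K)) (d : ℕ)
    (p : MvPolynomial (Fin n) K) :
    homogeneousComponent d (polyAct g p) = polyAct g (homogeneousComponent d p) := by
  conv_lhs => rw [← sum_homogeneousComponent p, map_sum]
  refine homogeneousComponent_sum_of_isHomogeneous
    (fun i => polyAct g (homogeneousComponent i p))
    (fun i => polyAct_isHomogeneous g (homogeneousComponent_isHomogeneous i p)) _ _ fun h => ?_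
  rw [homogeneousComponent_eq_zero _ _ (by omega), map_zero]

lemma totalDegree_polyAct_le (g : (Fin n → K) ≃ₗ[K] (Fin n → K)) (p : MvPolynomial (Fin n) K) :
    (polyAct g p).totalDegree ≤ p.totalDegree := by
  rw [← sum_homogeneousComponent p, map_sum]
  refine totalDegree_finsetSum_le fun i hi => ?_
  rw [sum_homogeneousComponent]
  exact (polyAct_isHomogeneous g (homogeneousComponent_isHomogeneous i p)).totalDegree_le.trans
    (Nat.lt_succ_iff.mp (Finset.mem_range.mp hi))

variable {W : Subgroup ((Fin n → K) ≃ₗ[K] (Fin n → K))}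

lemma homogeneousComponent_mem_invariantsAlg {p : MvPolynomial (Fin n) K}
    (hp : p ∈ invariantsAlg W) (d : ℕ) : homogeneousComponent d p ∈ invariantsAlg W :=
  fun g hg => by rw [← polyAct_homogeneousComponent, hp g hg]

lemma C_mem_invariantsAlg (c : K) : (C c : MvPolynomial (Fin n) K) ∈ invariantsAlg W :=
  (invariantsAlg W).algebraMap_mem c

section Reynolds

variable [Fintype W]

/-- The sum of the translates of a polynomial under a finite group. -/
noncomputable def translateSum (W : Subgroup ((Fin n → K) ≃ₗ[K] (Fin n → K))) [Fintype W] :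
    MvPolynomial (Fin n) K →ₗ[K] MvPolynomial (Fin n) K :=
  ∑ w : W, (polyAct (w : (Fin n → K) ≃ₗ[K] (Fin n → K))).toLinearMap

lemma translateSum_apply (p : MvPolynomial (Fin n) K) :
    translateSum W p = ∑ w : W, polyAct (w : (Fin n → K) ≃ₗ[K] (Fin n → K)) p := by
  simp [translateSum]

lemma translateSum_mem (p : MvPolynomial (Fin n) K) : translateSum W p ∈ invariantsAlg W := by
  intro g hg
  simp only [translateSum_apply, map_sum, polyAct_polyAct]
  exact Equiv.sum_comp (Equiv.mulRight (⟨g, hg⟩ : W))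
    fun w : W => polyAct (w : (Fin n → K) ≃ₗ[K] (Fin n → K)) p

lemma translateSum_mul {r : MvPolynomial (Fin n) K} (hr : r ∈ invariantsAlg W)
    (p : MvPolynomial (Fin n) K) : translateSum W (r * p) = r * translateSum W p := by
  simp only [translateSum_apply, map_mul, Finset.mul_sum]
  exact Finset.sum_congr rfl fun w _ => by rw [hr w w.2]

lemma translateSum_of_mem {r : MvPolynomial (Fin n) K} (hr : r ∈ invariantsAlg W) :
    translateSum W r = (Fintype.card W : K) • r := by
  rw [translateSum_apply, Finset.sum_congr rfl fun (w : W) _ => hr w w.2]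
  simp [Nat.cast_smul_eq_nsmul]

/-- The Reynolds operator, averaging a polynomial over a finite group. -/
noncomputable def reynolds (W : Subgroup ((Fin n → K) ≃ₗ[K] (Fin n → K))) [Fintype W] :
    MvPolynomial (Fin n) K →ₗ[K] MvPolynomial (Fin n) K :=
  (Fintype.card W : K)⁻¹ • translateSum W

lemma reynolds_mem (p : MvPolynomial (Fin n) K) : reynolds W p ∈ invariantsAlg W :=
  (invariantsAlg W).smul_mem (translateSum_mem p) _

lemma reynolds_mul {r : MvPolynomial (Fin n) K} (hr : r ∈ invariantsAlg W)
    (p : MvPolynomial (Fin n) K) : reynolds W (r * p) = r * reynolds W p := by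
  simp [reynolds, translateSum_mul hr]

lemma reynolds_of_mem [CharZero K] {r : MvPolynomial (Fin n) K} (hr : r ∈ invariantsAlg W) :
    reynolds W r = r := by
  simp [reynolds, translateSum_of_mem hr, smul_smul]

lemma reynolds_sub_mem [CharZero K] {I : Ideal (MvPolynomial (Fin n) K)}
    {p : MvPolynomial (Fin n) K} (h : ∀ g ∈ W, polyAct g p - p ∈ I) : reynolds W p - p ∈ I := by
  have : reynolds W p - p = C (Fintype.card W : K)⁻¹ *
      ∑ w : W, (polyAct (w : (Fin n → K) ≃ₗ[K] (Fin n → K)) p - p) := by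
    have hc : (C (Fintype.card W : K)⁻¹ * (Fintype.card W : MvPolynomial (Fin n) K)) = 1 := by
      rw [← map_natCast C, ← C_mul]; simp
    rw [Finset.sum_sub_distrib, mul_sub]
    simp [reynolds, translateSum_apply, ← mul_assoc, hc, smul_eq_C_mul]
  rw [this]
  exact I.mul_mem_left _ (I.sum_mem fun w _ => h w w.2)

end Reynolds

end Action

section Derivatives

/-- The chain rule for a derivation evaluated at a polynomial expression. -/
lemma derivation_aeval {ι R A M : Type*} [Fintype ι] [CommRing R] [CommRing A] [Algebra R A]
    [AddCommGroup M] [Module A M] [Module R M] (D : Derivation R A M)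
    (f : ι → A) (p : MvPolynomial ι R) :
    D (aeval f p) = ∑ i, aeval f (pderiv i p) • D (f i) := by
  classical
  induction p using MvPolynomial.induction_on with
  | C a => simp
  | add p q hp hq => simp [hp, hq, add_smul, Finset.sum_add_distrib]
  | mul_X p i hp =>
    simp only [map_mul, aeval_X, Derivation.leibniz, hp, smul_eq_mul, pderiv_X, map_add,
      add_smul, Finset.sum_add_distrib, Finset.smul_sum, smul_smul]
    congr 1
    rw [Finset.sum_eq_single i]
    · simp
    · intro j _ hj
      simp [hj.symm]
    · simp

lemma totalDegree_pderiv_le {σ R : Type*} [CommSemiring R] (i : σ) (p : MvPolynomial σ R) :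
    (pderiv i p).totalDegree ≤ p.totalDegree - 1 := by
  classical
  refine Finset.sup_le fun m hm => ?_
  have h : m + Finsupp.single i 1 ∈ p.support := by
    rw [mem_support_iff] at hm ⊢
    rw [coeff_pderiv] at hm
    exact fun h => hm (by rw [h]; simp)
  have := le_totalDegree h
  rw [Finsupp.sum_add_index' (by simp) (by simp), Finsupp.sum_single_index rfl] at this
  omega

lemma totalDegree_eq_zero_of_pderiv_eq_zero {σ R : Type*} [CommRing R] [IsDomain R] [CharZero R]
    {p : MvPolynomial σ R} (h : ∀ i, pderiv i p = 0) : p.totalDegree = 0 := by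
  classical
  rw [totalDegree_eq_zero_iff]
  intro m hm i
  by_contra hi
  have h1 := congrArg (coeff (m - Finsupp.single i 1)) (h i)
  rw [coeff_pderiv, coeff_zero, tsub_add_cancel_of_le
    (Finsupp.single_le_iff.mpr (Nat.one_le_iff_ne_zero.mpr hi))] at h1
  rcases mul_eq_zero.mp h1 with h2 | h2
  · exact mem_support_iff.mp hm h2
  · exact Nat.cast_add_one_ne_zero _ h2

end Derivatives

section Reflections

/-- A pseudo-reflection moves every polynomial by a multiple of a fixed nonzero linear form. -/
lemma IsPseudoReflection.exists_linearForm {s : (Fin n → K) ≃ₗ[K] (Fin n → K)}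
    (hs : IsPseudoReflection s) : ∃ l : MvPolynomial (Fin n) K, l ≠ 0 ∧ l.IsHomogeneous 1 ∧
      ∀ p, l ∣ polyAct s p - p := by
  classical
  obtain ⟨-, -, H, hH, hfix⟩ := hs
  have hlt : H < ⊤ := by
    refine lt_top_iff_ne_top.mpr fun h => ?_
    rw [h, finrank_top, Module.finrank_fin_fun] at hH
    omega
  obtain ⟨f, hf0, hf⟩ := Submodule.exists_le_ker_of_lt_top H hlt
  have hker : H = LinearMap.ker f := by
    refine Submodule.eq_of_le_of_finrank_eq hf ?_
    have := Module.Dual.finrank_ker_add_one_of_ne_zero (f := f) hf0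
    rw [Module.finrank_fin_fun] at this
    omega
  obtain ⟨v, hv⟩ : ∃ v, f v = 1 := (LinearMap.surjective_of_ne_zero hf0) 1
  have hsx : ∀ x, s x = x + f x • (s v - v) := by
    intro x
    have : x - f x • v ∈ H := by rw [hker]; simp [hv]
    have := hfix _ this
    rw [map_sub, map_smul] at this
    rw [smul_sub]
    linear_combination (exp := 1) this
  let c : Fin n → K := fun j => f (Pi.single j 1)
  have hmat : ∀ i j, glMatrix s i j = (1 : Matrix (Fin n) (Fin n) K) i j + (s v - v) i * c j := by
    intro i j
    have := congrFun (glMatrix_mulVec s (Pi.single j 1)) i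
    rw [Matrix.mulVec_single_one, hsx] at this
    simp only [Matrix.col_apply, Pi.add_apply, Pi.smul_apply, smul_eq_mul] at this
    rw [this, Matrix.one_apply, Pi.single_apply]
    simp only [c]; ring
  refine ⟨∑ j, C (c j) * X j, ?_, IsHomogeneous.sum _ _ _ fun j _ => isHomogeneous_C_mul_X _ _, ?_⟩
  · intro h
    refine hf0 (LinearMap.pi_ext' fun j => LinearMap.ext_ring ?_)
    have := congrArg (coeff (Finsupp.single j 1)) h
    simpa [coeff_sum, coeff_C_mul, coeff_X, Finsupp.single_left_inj, c] using this
  · intro p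
    rw [← Ideal.mem_span_singleton, ← Ideal.Quotient.mk_eq_mk_iff_sub_mem]
    set I := Ideal.span {∑ j, C (c j) * X j}
    have : (Ideal.Quotient.mkₐ K I).comp (polyAct s) = Ideal.Quotient.mkₐ K I := by
      refine MvPolynomial.algHom_ext fun i => ?_
      refine (Ideal.Quotient.mk_eq_mk_iff_sub_mem _ _).mpr (Ideal.mem_span_singleton.mpr
        ⟨C ((s v - v) i), ?_⟩)
      change polyAct s (X i) - X i = _
      simp only [polyAct_X, hmat, map_add, map_mul, add_mul, Finset.sum_add_distrib,
        Matrix.one_apply, Finset.sum_mul]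
      simp [apply_ite C, mul_comm, mul_assoc]
    exact DFunLike.congr_fun this p

lemma totalDegree_quotient_lt {s : (Fin n → K) ≃ₗ[K] (Fin n → K)}
    {l p q : MvPolynomial (Fin n) K} (hl0 : l ≠ 0) (hl : l.IsHomogeneous 1)
    (h : polyAct s p - p = l * q) : q = 0 ∨ q.totalDegree < p.totalDegree := by
  by_cases hq : q = 0
  · exact Or.inl hq
  · right
    have h1 := totalDegree_mul_of_isDomain hl0 hq
    rw [hl.totalDegree hl0, ← h] at h1
    have h2 := totalDegree_sub (polyAct s p) p
    have h3 := totalDegree_polyAct_le s p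
    omega

end Reflections

section HilbertIdeal

variable {W : Subgroup ((Fin n → K) ≃ₗ[K] (Fin n → K))}

/-- The ideal generated by the invariants without constant term. -/
noncomputable def hilbertIdeal (W : Subgroup ((Fin n → K) ≃ₗ[K] (Fin n → K))) :
    Ideal (MvPolynomial (Fin n) K) :=
  Ideal.span {r | r ∈ invariantsAlg W ∧ constantCoeff r = 0}

lemma polyAct_mem_hilbertIdeal {g : (Fin n → K) ≃ₗ[K] (Fin n → K)} (hg : g ∈ W)
    {p : MvPolynomial (Fin n) K} (hp : p ∈ hilbertIdeal W) : polyAct g p ∈ hilbertIdeal W := by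
  have : hilbertIdeal W ≤ (hilbertIdeal W).comap (polyAct g) :=
    Ideal.span_le.mpr fun r hr => by
      show polyAct g r ∈ hilbertIdeal W
      rw [hr.1 g hg]
      exact Ideal.subset_span hr
  exact this hp

/-- A polynomial fixed modulo the Hilbert ideal by generators of the group is fixed modulo the
Hilbert ideal by the whole group. -/
lemma polyAct_sub_mem_of_closure {S : Set ((Fin n → K) ≃ₗ[K] (Fin n → K))}
    (hS : Subgroup.closure S = W) {p : MvPolynomial (Fin n) K}
    (h : ∀ g ∈ S, polyAct g p - p ∈ hilbertIdeal W) {g : (Fin n → K) ≃ₗ[K] (Fin n → K)}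
    (hg : g ∈ W) : polyAct g p - p ∈ hilbertIdeal W := by
  rw [← hS] at hg
  induction hg using Subgroup.closure_induction with
  | mem x hx => exact h x hx
  | one => simp [polyAct_one]
  | mul x y hx hy hpx hpy =>
    rw [← polyAct_polyAct]
    have := polyAct_mem_hilbertIdeal (hS ▸ hy) hpx
    rw [map_sub] at this
    simpa using add_mem this hpy
  | inv x hx hpx =>
    have := polyAct_mem_hilbertIdeal (hS ▸ inv_mem hx) hpx
    rw [map_sub, polyAct_inv_polyAct] at this
    simpa using neg_mem this

/-- Chevalley's lemma: a relation between invariants `r i` with polynomial coefficients `g i`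
reduces, modulo the Hilbert ideal, to the relations that hold with constants `c i` orthogonal to the
constant terms of all invariant relations. -/
lemma sum_C_mul_mem_hilbertIdeal [CharZero K] [Fintype W]
    (hW : Subgroup.closure {g | g ∈ W ∧ IsPseudoReflection g} = W) {ι : Type*} [Fintype ι]
    {r : ι → MvPolynomial (Fin n) K} (hr : ∀ i, r i ∈ invariantsAlg W) {c : ι → K}
    (hc : ∀ a : ι → MvPolynomial (Fin n) K, (∀ i, a i ∈ invariantsAlg W) →
      ∑ i, r i * a i = 0 → ∑ i, c i * constantCoeff (a i) = 0)
    (g : ι → MvPolynomial (Fin n) K) (hg : ∑ i, r i * g i = 0) :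
    ∑ i, C (c i) * g i ∈ hilbertIdeal W := by
  suffices H : ∀ N : ℕ, ∀ g : ι → MvPolynomial (Fin n) K,
      (∀ i, g i = 0 ∨ (g i).totalDegree < N) → ∑ i, r i * g i = 0 →
      ∑ i, C (c i) * g i ∈ hilbertIdeal W by
    refine H ((Finset.univ.sup fun i => (g i).totalDegree) + 1) g (fun i => Or.inr ?_) hg
    exact Nat.lt_succ_of_le (Finset.le_sup (f := fun i => (g i).totalDegree) (Finset.mem_univ i))
  intro N
  induction N with
  | zero =>
    intro g hg _
    have : ∀ i, g i = 0 := fun i => (hg i).resolve_right (Nat.not_lt_zero _)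
    simp [this]
  | succ N ih =>
    intro g hdeg hg
    have hrefl : ∀ s ∈ {g | g ∈ W ∧ IsPseudoReflection g},
        polyAct s (∑ i, C (c i) * g i) - ∑ i, C (c i) * g i ∈ hilbertIdeal W := by
      rintro s ⟨hsW, hs⟩
      obtain ⟨l, hl0, hl, hdvd⟩ := hs.exists_linearForm
      choose q hq using fun i => hdvd (g i)
      have hrel : ∑ i, r i * q i = 0 := by
        refine (mul_eq_zero.mp ?_).resolve_left hl0
        calc l * ∑ i, r i * q i = ∑ i, (polyAct s (r i * g i) - r i * g i) := by
              rw [Finset.mul_sum]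
              refine Finset.sum_congr rfl fun i _ => ?_
              rw [map_mul, hr i s hsW, ← mul_sub, hq]
              ring
          _ = 0 := by rw [Finset.sum_sub_distrib, ← map_sum, hg]; simp
      have hmem := ih q (fun i => ?_) hrel
      · have : polyAct s (∑ i, C (c i) * g i) - ∑ i, C (c i) * g i
            = l * ∑ i, C (c i) * q i := by
          rw [map_sum, ← Finset.sum_sub_distrib, Finset.mul_sum]
          refine Finset.sum_congr rfl fun i _ => ?_
          rw [map_mul, MvPolynomial.algHom_C, MvPolynomial.algebraMap_eq, ← mul_sub, hq]
          ring
        rw [this]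
        exact Ideal.mul_mem_left _ _ hmem
      · rcases totalDegree_quotient_lt hl0 hl (hq i) with h | h
        · exact Or.inl h
        · rcases hdeg i with h' | h'
          · rw [h', totalDegree_zero] at h
            omega
          · right; omega
    have hall := reynolds_sub_mem fun w hw => polyAct_sub_mem_of_closure hW hrefl hw
    have hmem : reynolds W (∑ i, C (c i) * g i) ∈ hilbertIdeal W := by
      refine Ideal.subset_span ⟨reynolds_mem _, ?_⟩
      have := hc (fun i => reynolds W (g i)) (fun i => reynolds_mem _) (by
        simp only [← reynolds_mul (hr _)]
        rw [← map_sum, hg, map_zero])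
      simpa [reynolds_mul (C_mem_invariantsAlg _)] using this
    simpa using sub_mem hmem hall

/-- Constants as in `sum_C_mul_mem_hilbertIdeal` exist for invariants which are not all zero. -/
lemma exists_ne_zero_orthogonal {ι : Type*} [Fintype ι]
    {r : ι → MvPolynomial (Fin n) K} (hr : r ≠ 0) :
    ∃ c : ι → K, c ≠ 0 ∧ ∀ a : ι → MvPolynomial (Fin n) K, (∀ i, a i ∈ invariantsAlg W) →
      ∑ i, r i * a i = 0 → ∑ i, c i * constantCoeff (a i) = 0 := by
  classical
  let Z : Submodule K (ι → K) :=
    { carrier := {z | ∃ a : ι → MvPolynomial (Fin n) K, (∀ i, a i ∈ invariantsAlg W) ∧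
        ∑ i, r i * a i = 0 ∧ ∀ i, constantCoeff (a i) = z i}
      zero_mem' := ⟨0, fun i => zero_mem _, by simp, by simp⟩
      add_mem' := by
        rintro x y ⟨a, ha, hra, hax⟩ ⟨b, hb, hrb, hby⟩
        refine ⟨a + b, fun i => add_mem (ha i) (hb i), ?_, fun i => by simp [hax, hby]⟩
        simp [mul_add, Finset.sum_add_distrib, hra, hrb]
      smul_mem' := by
        rintro t x ⟨a, ha, hra, hax⟩
        refine ⟨t • a, fun i => Subalgebra.smul_mem _ (ha i) t, ?_, fun i => by simp [hax]⟩
        simp [← Finset.smul_sum, hra] }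
  have hZ : Z < ⊤ := by
    refine lt_top_iff_ne_top.mpr fun h => hr ?_
    have hex : ∀ j, Pi.single j (1 : K) ∈ Z := fun j => h ▸ Submodule.mem_top
    choose A _ hrA hA using hex
    have hdet : (Matrix.of A).det ≠ 0 := by
      intro h0
      have := congrArg constantCoeff h0
      rw [RingHom.map_det, map_zero] at this
      have h1 : constantCoeff.mapMatrix (Matrix.of A) = (1 : Matrix ι ι K) := by
        ext i j
        simp [hA, Matrix.one_apply, Pi.single_apply, eq_comm]
      rw [h1, Matrix.det_one] at this
      exact one_ne_zero this
    refine Matrix.eq_zero_of_mulVec_eq_zero hdet ?_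
    ext1 j
    refine Eq.trans ?_ (hrA j)
    simp [Matrix.mulVec, dotProduct, mul_comm]
  obtain ⟨f, hf0, hf⟩ := Submodule.exists_le_ker_of_lt_top Z hZ
  refine ⟨fun i => f (Pi.single i 1), fun h => hf0 ?_, fun a ha hra => ?_⟩
  · exact LinearMap.pi_ext' fun i => LinearMap.ext_ring (by simpa using congrFun h i)
  · have h1 : f (fun i => constantCoeff (a i)) = 0 := hf ⟨a, ha, hra, fun i => rfl⟩
    have h2 : (fun i => constantCoeff (a i)) =
        ∑ i, constantCoeff (a i) • (Pi.single i 1 : ι → K) := by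
      ext j
      simp [Finset.sum_apply, Pi.single_apply]
    rw [h2, map_sum] at h1
    simpa [mul_comm] using h1

end HilbertIdeal

section Generators

lemma homogeneousComponent_mul_of_isHomogeneous {σ R : Type*} [CommSemiring R]
    {t : MvPolynomial σ R} {e : ℕ} (ht : t.IsHomogeneous e) (d : ℕ) (p : MvPolynomial σ R) :
    homogeneousComponent d (p * t) = if e ≤ d then homogeneousComponent (d - e) p * t else 0 := by
  classical
  conv_lhs => rw [← sum_homogeneousComponent p, Finset.sum_mul, map_sum]
  rw [Finset.sum_congr rfl fun i _ => homogeneousComponent_of_mem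
    ((homogeneousComponent_isHomogeneous i p).mul ht)]
  split_ifs with hed
  · rw [Finset.sum_eq_single (d - e)]
    · rw [if_pos (by omega)]
    · intro i _ hi
      rw [if_neg (by omega)]
    · intro hi
      rw [if_pos (by omega), homogeneousComponent_eq_zero, zero_mul]
      rw [Finset.mem_range] at hi
      omega
  · exact Finset.sum_eq_zero fun i _ => if_neg (by omega)

variable {W : Subgroup ((Fin n → K) ≃ₗ[K] (Fin n → K))}

/-- The homogeneous invariants of positive degree. -/
def homogeneousInvariants (W : Subgroup ((Fin n → K) ≃ₗ[K] (Fin n → K))) :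
    Set (MvPolynomial (Fin n) K) :=
  {r | r ∈ invariantsAlg W ∧ ∃ d, 0 < d ∧ r.IsHomogeneous d}

lemma span_homogeneousInvariants :
    Ideal.span (homogeneousInvariants W) = hilbertIdeal W := by
  refine le_antisymm (Ideal.span_mono ?_) (Ideal.span_le.mpr ?_)
  · rintro r ⟨hr, d, hd, hrd⟩
    refine ⟨hr, ?_⟩
    rw [constantCoeff_eq]
    exact hrd.coeff_eq_zero (by simpa using hd.ne)
  · rintro r ⟨hr, h0⟩
    rw [SetLike.mem_coe, ← sum_homogeneousComponent r]
    refine Ideal.sum_mem _ fun i _ => ?_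
    rcases Nat.eq_zero_or_pos i with rfl | hi
    · rw [homogeneousComponent_zero, ← constantCoeff_eq, h0, C_0]
      exact zero_mem _
    · exact Ideal.subset_span
        ⟨homogeneousComponent_mem_invariantsAlg hr i, i, hi, homogeneousComponent_isHomogeneous i r⟩

attribute [local instance] MvPolynomial.gradedAlgebra in
/-- Homogeneous elements generating an ideal modulo the maximal homogeneous ideal generate it. -/
lemma mem_span_of_le_sup {ι σ : Type*} [Finite σ] {f : ι → MvPolynomial σ K} {d : ι → ℕ}
    (hf : ∀ i, (f i).IsHomogeneous (d i)) {I : Ideal (MvPolynomial σ K)}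
    (hI : I ≤ Ideal.span (Set.range f) ⊔ RingHom.ker (constantCoeff (σ := σ) (R := K)) * I)
    {t : MvPolynomial σ K} {e : ℕ} (ht : t.IsHomogeneous e) (htI : t ∈ I) :
    t ∈ Ideal.span (Set.range f) := by
  obtain ⟨r, hr, hrI⟩ := Submodule.exists_sub_one_mem_and_smul_le_of_fg_of_le_sup
    (I := RingHom.ker (constantCoeff (σ := σ) (R := K))) (IsNoetherian.noetherian I) le_rfl hI
  have h1 : r * t ∈ Ideal.span (Set.range f) :=
    hrI (Submodule.smul_mem_pointwise_smul t r I htI)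
  have h2 : (Ideal.span (Set.range f)).IsHomogeneous (homogeneousSubmodule σ K) := by
    refine Ideal.homogeneous_span _ _ ?_
    rintro _ ⟨i, rfl⟩
    exact ⟨d i, hf i⟩
  have h3 := homogeneousComponent_mem_of_mem h2 h1 e
  rw [homogeneousComponent_mul_of_isHomogeneous ht, if_pos le_rfl, Nat.sub_self,
    homogeneousComponent_zero, ← constantCoeff_eq] at h3
  have h4 : constantCoeff r = 1 := by
    have := RingHom.mem_ker.mp hr
    rwa [map_sub, map_one, sub_eq_zero] at this
  rwa [h4, C_1, one_mul] at h3

/-- There are homogeneous invariants whose classes form a basis of the Hilbert ideal modulo its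
product with the maximal homogeneous ideal. -/
lemma exists_minimal_generators (W : Subgroup ((Fin n → K) ≃ₗ[K] (Fin n → K))) :
    ∃ (m : ℕ) (f : Fin m → MvPolynomial (Fin n) K) (d : Fin m → ℕ),
      (∀ i, f i ∈ invariantsAlg W) ∧ (∀ i, 0 < d i) ∧ (∀ i, (f i).IsHomogeneous (d i)) ∧
      homogeneousInvariants W ⊆ Ideal.span (Set.range f) ∧
      ∀ c : Fin m → K, ∑ i, C (c i) * f i ∈
        RingHom.ker (constantCoeff (σ := Fin n) (R := K)) * hilbertIdeal W → c = 0 := by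
  classical
  set J := RingHom.ker (constantCoeff (σ := Fin n) (R := K)) * hilbertIdeal W with hJ
  obtain ⟨T, hT, hTspan⟩ := (Submodule.fg_span_iff_fg_span_finset_subset
    (R := MvPolynomial (Fin n) K) (homogeneousInvariants W)).mp (IsNoetherian.noetherian _)
  obtain ⟨κ, a, ha, hspan, hli⟩ := exists_linearIndependent' K
    (fun t : T => Ideal.Quotient.mkₐ K J t)
  have : Finite κ := Finite.of_injective a ha
  obtain ⟨m, ⟨e⟩⟩ := Finite.exists_equiv_fin κ
  let f : Fin m → MvPolynomial (Fin n) K := fun i => a (e.symm i)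
  have hfT : ∀ i, f i ∈ homogeneousInvariants W := fun i => hT (a (e.symm i)).2
  choose hfW d hd hfd using hfT
  refine ⟨m, f, d, hfW, hd, hfd, ?_, ?_⟩
  · rintro t ⟨htW, e', he', ht⟩
    refine mem_span_of_le_sup hfd (I := hilbertIdeal W) ?_ ht
      (span_homogeneousInvariants (W := W) ▸ Ideal.subset_span ⟨htW, e', he', ht⟩)
    nth_rewrite 1 [← span_homogeneousInvariants]
    refine hTspan.trans_le (Submodule.span_le.mpr fun t ht => ?_)
    have h1 : Ideal.Quotient.mkₐ K J t ∈ Submodule.span K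
        (Set.range ((fun t : T => Ideal.Quotient.mkₐ K J t) ∘ a)) := by
      rw [hspan]
      exact Submodule.subset_span ⟨⟨t, ht⟩, rfl⟩
    rw [← e.symm.surjective.range_comp] at h1
    obtain ⟨c, hc⟩ := (Submodule.mem_span_range_iff_exists_fun K).mp h1
    have h2 : Ideal.Quotient.mk J (∑ i, C (c i) * f i) = Ideal.Quotient.mk J t := by
      change Ideal.Quotient.mkₐ K J (∑ i, C (c i) * f i) = Ideal.Quotient.mkₐ K J t
      rw [← hc, map_sum]
      exact Finset.sum_congr rfl fun i _ => by rw [← smul_eq_C_mul, map_smul]; rfl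
    rw [Ideal.Quotient.mk_eq_mk_iff_sub_mem] at h2
    rw [← sub_sub_cancel (∑ i, C (c i) * f i) t]
    refine sub_mem (Submodule.mem_sup_left ?_) (Submodule.mem_sup_right h2)
    exact Ideal.sum_mem _ fun i _ => Ideal.mul_mem_left _ _ (Ideal.subset_span ⟨i, rfl⟩)
  · intro c hc
    have h1 := (linearIndependent_equiv e.symm).mpr hli
    refine funext (Fintype.linearIndependent_iff.mp h1 c ?_)
    have h2 : Ideal.Quotient.mkₐ K J (∑ i, C (c i) * f i) = 0 :=
      Ideal.Quotient.eq_zero_iff_mem.mpr hc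
    rw [← h2, map_sum]
    exact Finset.sum_congr rfl fun i _ => by rw [← smul_eq_C_mul, map_smul]; rfl

lemma adjoin_eq_invariantsAlg [CharZero K] [Fintype W] {m : ℕ}
    {f : Fin m → MvPolynomial (Fin n) K} {d : Fin m → ℕ} (hf : ∀ i, f i ∈ invariantsAlg W)
    (hd : ∀ i, 0 < d i) (hfd : ∀ i, (f i).IsHomogeneous (d i))
    (hspan : homogeneousInvariants W ⊆ Ideal.span (Set.range f)) :
    Algebra.adjoin K (Set.range f) = invariantsAlg W := by
  refine le_antisymm (Algebra.adjoin_le (Set.range_subset_iff.mpr hf)) ?_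
  have key : ∀ e : ℕ, ∀ r ∈ invariantsAlg W, r.IsHomogeneous e →
      r ∈ Algebra.adjoin K (Set.range f) := by
    intro e
    induction e using Nat.strong_induction_on with
    | _ e ih =>
      intro r hr hre
      rcases Nat.eq_zero_or_pos e with rfl | he
      · rw [← homogeneousComponent_eq_self hre, homogeneousComponent_zero]
        exact Subalgebra.algebraMap_mem _ _
      · obtain ⟨a, ha⟩ := Ideal.mem_span_range_iff_exists_fun.mp (hspan ⟨hr, e, he, hre⟩)
        have h1 : r = ∑ i, homogeneousComponent e (reynolds W (a i) * f i) := by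
          conv_lhs => rw [← homogeneousComponent_eq_self hre, ← reynolds_of_mem hr, ← ha]
          rw [map_sum, map_sum]
          refine Finset.sum_congr rfl fun i _ => ?_
          rw [mul_comm, reynolds_mul (hf i), mul_comm]
        rw [h1]
        refine sum_mem fun i _ => ?_
        rw [homogeneousComponent_mul_of_isHomogeneous (hfd i)]
        split_ifs with hi
        · refine mul_mem (ih _ ?_ _ (homogeneousComponent_mem_invariantsAlg (reynolds_mem _) _)
            (homogeneousComponent_isHomogeneous _ _)) (Algebra.subset_adjoin ⟨i, rfl⟩)
          have := hd i
          omega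
        · exact zero_mem _
  intro r hr
  rw [← sum_homogeneousComponent r]
  exact sum_mem fun i _ => key i _ (homogeneousComponent_mem_invariantsAlg hr i)
    (homogeneousComponent_isHomogeneous i r)

lemma algebraicIndependent_of_minimal [CharZero K] [Fintype W]
    (hW : Subgroup.closure {g | g ∈ W ∧ IsPseudoReflection g} = W) {m : ℕ}
    {f : Fin m → MvPolynomial (Fin n) K} {d : Fin m → ℕ} (hf : ∀ i, f i ∈ invariantsAlg W)
    (hd : ∀ i, 0 < d i) (hfd : ∀ i, (f i).IsHomogeneous (d i))
    (hmin : ∀ c : Fin m → K, ∑ i, C (c i) * f i ∈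
        RingHom.ker (constantCoeff (σ := Fin n) (R := K)) * hilbertIdeal W → c = 0) :
    AlgebraicIndependent K f := by
  rw [algebraicIndependent_iff]
  suffices H : ∀ N : ℕ, ∀ h : MvPolynomial (Fin m) K, h.totalDegree = N →
      aeval f h = 0 → h = 0 from fun h => H _ h rfl
  intro N
  induction N using Nat.strong_induction_on with
  | _ N ih =>
    intro h hN h0
    by_cases hdeg : h.totalDegree = 0
    · rw [totalDegree_eq_zero_iff_eq_C] at hdeg
      rw [hdeg, algHom_C, algebraMap_eq] at h0
      rw [hdeg, C_injective (Fin n) K (h0.trans C_0.symm), C_0]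
    have hder : ∀ i, aeval f (pderiv i h) = 0 → pderiv i h = 0 := by
      intro i hi
      have := totalDegree_pderiv_le i h
      exact ih _ (by omega) _ rfl hi
    by_cases hr : (fun i => aeval f (pderiv i h)) = 0
    · exact absurd (totalDegree_eq_zero_of_pderiv_eq_zero fun i => hder i (congrFun hr i)) hdeg
    exfalso
    have hinv : ∀ p : MvPolynomial (Fin m) K, aeval f p ∈ invariantsAlg W := fun p => by
      have : (aeval f p : MvPolynomial (Fin n) K) ∈ Algebra.adjoin K (Set.range f) := by
        rw [Algebra.adjoin_range_eq_range_aeval]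
        exact ⟨p, rfl⟩
      exact Algebra.adjoin_le (Set.range_subset_iff.mpr hf) this
    obtain ⟨c, hc0, hc⟩ := exists_ne_zero_orthogonal (W := W) hr
    have hmem : ∀ k, ∑ i, C (c i) * pderiv k (f i) ∈ hilbertIdeal W := fun k =>
      sum_C_mul_mem_hilbertIdeal hW (fun i => hinv _) hc _ (by
        have := derivation_aeval (pderiv k) f h
        rw [h0, map_zero] at this
        simpa using this.symm)
    have heuler : ∑ i, C (c i * d i) * f i =
        ∑ k, X k * ∑ i, C (c i) * pderiv k (f i) := by
      simp only [Finset.mul_sum]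
      rw [Finset.sum_comm]
      refine Finset.sum_congr rfl fun i _ => ?_
      have := (hfd i).sum_X_mul_pderiv
      rw [C_mul, mul_assoc, map_natCast, ← nsmul_eq_mul, ← this, Finset.mul_sum]
      exact Finset.sum_congr rfl fun k _ => by ring
    have := hmin (fun i => c i * d i) (by
      rw [heuler]
      exact Ideal.sum_mem _ fun k _ => Ideal.mul_mem_mul (by simp [RingHom.mem_ker]) (hmem k))
    refine hc0 (funext fun i => ?_)
    exact (mul_eq_zero.mp (congrFun this i)).resolve_right (Nat.cast_ne_zero.mpr (hd i).ne')

/-- A finite group generated by pseudo-reflections has a polynomial ring of invariants. -/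
theorem isPolynomialRing_of_closure_eq [CharZero K] [Finite W]
    (hW : Subgroup.closure {g | g ∈ W ∧ IsPseudoReflection g} = W) :
    IsPolynomialRing (invariantsAlg W) := by
  have := Fintype.ofFinite W
  obtain ⟨m, f, d, hf, hd, hfd, hspan, hmin⟩ := exists_minimal_generators W
  have hind := algebraicIndependent_of_minimal hW hf hd hfd hmin
  have hadj := adjoin_eq_invariantsAlg hf hd hfd hspan
  exact ⟨m, ⟨hind.aevalEquiv.trans (Subalgebra.equivOfEq _ _ hadj)⟩⟩

end Generators

section Jacobian

open scoped TensorProduct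

/-- If a derivation kills the sums over a finite set `θ` of algebra endomorphisms, then its values
are killed by the squared product of the differences `b v - θ v (b v)` over the nontrivial `v`. -/
lemma sq_prod_smul_derivation_eq_zero [CharZero K] {P M ι : Type*} [CommRing P] [Algebra K P]
    [AddCommGroup M] [Module P M] [Module K M] [IsScalarTower K P M] [Fintype ι] [DecidableEq ι]
    (D : Derivation K P M) (θ : ι → P →ₐ[K] P) {T : Finset ι} (hT0 : T.Nonempty)
    (hT : ∀ w ∈ T, ∀ x, θ w x = x) (hD : ∀ x, D (∑ w, θ w x) = 0) (b : ι → P) (x : P) :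
    (∏ v ∈ Tᶜ, (b v - θ v (b v))) ^ 2 • D x = 0 := by
  let μ : ι → P ⊗[K] P →ₐ[K] P := fun w => Algebra.TensorProduct.productMap (AlgHom.id K P) (θ w)
  have hμ : ∀ w a c, μ w (a ⊗ₜ c) = a * θ w c := fun w a c => by simp [μ]
  let δ : ι → P ⊗[K] P →ₗ[K] M := fun w => TensorProduct.lift (LinearMap.mk₂ K
    (fun a c => θ w c • D a) (fun a a' c => by simp) (fun t a c => by
      rw [D.map_smul, smul_comm]) (fun a c c' => by simp [add_smul])
      (fun t a c => by simp [smul_assoc]))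
  have hδ : ∀ w a c, δ w (a ⊗ₜ c) = θ w c • D a := fun w a c => by simp [δ]
  have hδmul : ∀ w z z', δ w (z * z') = μ w z • δ w z' + μ w z' • δ w z := by
    intro w z z'
    induction z using TensorProduct.induction_on with
    | zero => simp
    | add z₁ z₂ h₁ h₂ => simp only [add_mul, map_add, h₁, h₂, add_smul, smul_add]; abel
    | tmul a c =>
      induction z' using TensorProduct.induction_on with
      | zero => simp
      | add z₁ z₂ h₁ h₂ => simp only [mul_add, map_add, h₁, h₂, add_smul, smul_add]; abel
      | tmul a' c' =>
        simp only [Algebra.TensorProduct.tmul_mul_tmul, hδ, hμ, Derivation.leibniz, map_mul,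
          smul_add, smul_smul]
        congr 2 <;> ring
  have htrace : ∀ z x, D (∑ w, μ w z * θ w x) = ∑ w, θ w x • δ w z := by
    intro z x
    induction z using TensorProduct.induction_on with
    | zero => simp
    | add z₁ z₂ h₁ h₂ =>
      simp only [map_add, add_mul, Finset.sum_add_distrib, smul_add] at h₁ h₂ ⊢
      rw [h₁, h₂]
    | tmul a c =>
      have h1 : ∑ w, μ w (a ⊗ₜ c) * θ w x = a * ∑ w, θ w (c * x) := by
        rw [Finset.mul_sum]
        exact Finset.sum_congr rfl fun w _ => by rw [hμ, map_mul, mul_assoc]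
      rw [h1, Derivation.leibniz, hD, smul_zero, zero_add, Finset.sum_smul]
      exact Finset.sum_congr rfl fun w _ => by rw [hδ, smul_smul, map_mul, mul_comm]
  set u := ∏ v ∈ Tᶜ, (b v - θ v (b v)) with hu
  let e : P ⊗[K] P := ∏ v ∈ Tᶜ, (1 ⊗ₜ b v - θ v (b v) ⊗ₜ 1)
  have hμe : ∀ w, μ w e = ∏ v ∈ Tᶜ, (θ w (b v) - θ v (b v)) := fun w => by
    simp [e, map_prod, hμ]
  have hμ0 : ∀ w ∉ T, μ w e = 0 := fun w hw => by
    rw [hμe]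
    exact Finset.prod_eq_zero (Finset.mem_compl.mpr hw) (sub_self _)
  have hμu : ∀ w ∈ T, μ w e = u := fun w hw => by
    rw [hμe, hu]
    exact Finset.prod_congr rfl fun v _ => by rw [hT w hw]
  have hkey : ∀ x, D ((T.card • u ^ 2) * x) = x • ∑ w ∈ T, δ w (e * e) := by
    intro x
    have h1 := htrace (e * e) x
    rw [← Finset.sum_subset (Finset.subset_univ T), ← Finset.sum_subset (Finset.subset_univ T)]
      at h1
    · rw [Finset.sum_congr rfl fun w hw => by rw [map_mul, hμu w hw, hT w hw],
        Finset.sum_const, Finset.sum_congr rfl fun w hw => by rw [hT w hw]] at h1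
      rw [Finset.smul_sum, ← h1, smul_mul_assoc, sq]
    · intro w _ hw
      rw [hδmul, hμ0 w hw, zero_smul, add_zero, smul_zero]
    · intro w _ hw
      rw [map_mul, hμ0 w hw, zero_mul, zero_mul]
  have h1 := hkey 1
  have h2 := hkey x
  rw [mul_one, one_smul] at h1
  rw [Derivation.leibniz, h1, add_eq_right, smul_assoc, ← Nat.cast_smul_eq_nsmul K] at h2
  exact (smul_eq_zero.mp h2).resolve_left (Nat.cast_ne_zero.mpr hT0.card_pos.ne')

/-- The Jacobian matrix of a family of polynomials. -/
noncomputable def jacobian {m k : ℕ} (F : Fin m → MvPolynomial (Fin k) K) :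
    Matrix (Fin m) (Fin k) (MvPolynomial (Fin k) K) :=
  Matrix.of fun i j => pderiv j (F i)

/-- If polynomials `F` generate all sums over the finite set `θ` of endomorphisms, then their
Jacobian determinant divides a power of any product of differences `b v - θ v (b v)`. -/
lemma det_jacobian_dvd [CharZero K] {m : ℕ} {ι : Type*} [Fintype ι] [DecidableEq ι]
    (θ : ι → MvPolynomial (Fin m) K →ₐ[K] MvPolynomial (Fin m) K) {T : Finset ι}
    (hT0 : T.Nonempty) (hT : ∀ w ∈ T, ∀ x, θ w x = x) {F : Fin m → MvPolynomial (Fin m) K}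
    (hF : ∀ x, ∃ y : MvPolynomial (Fin m) K, ∑ w, θ w x = aeval F y)
    (b : ι → MvPolynomial (Fin m) K) :
    (jacobian F).det ∣ ((∏ v ∈ Tᶜ, (b v - θ v (b v))) ^ 2) ^ m := by
  set U := (∏ v ∈ Tᶜ, (b v - θ v (b v))) ^ 2
  let N : Submodule (MvPolynomial (Fin m) K) (Fin m → MvPolynomial (Fin m) K) :=
    Submodule.span _ (Set.range fun i => jacobian F i)
  let D : Derivation K (MvPolynomial (Fin m) K) ((Fin m → MvPolynomial (Fin m) K) ⧸ N) :=
    mkDerivation K fun j => N.mkQ (Pi.single j 1)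
  have hDp : ∀ p, D p = N.mkQ fun j => pderiv j p := by
    intro p
    have h1 : (fun j => pderiv j p) =
        ∑ j, pderiv j p • (Pi.single j 1 : Fin m → MvPolynomial (Fin m) K) := by
      ext1 j
      simp [Finset.sum_apply, Pi.single_apply]
    have h2 := derivation_aeval D X p
    rw [aeval_X_left_apply] at h2
    rw [h2, h1, map_sum]
    refine Finset.sum_congr rfl fun j _ => ?_
    rw [aeval_X_left_apply, map_smul, mkDerivation_X]
  have hDF : ∀ i, D (F i) = 0 := fun i => by
    rw [hDp, Submodule.mkQ_apply, Submodule.Quotient.mk_eq_zero]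
    exact Submodule.subset_span ⟨i, rfl⟩
  have hD0 : ∀ x, D (∑ w, θ w x) = 0 := fun x => by
    obtain ⟨y, hy⟩ := hF x
    rw [hy, derivation_aeval]
    exact Finset.sum_eq_zero fun i _ => by rw [hDF, smul_zero]
  have hmem : ∀ j, U • (Pi.single j 1 : Fin m → MvPolynomial (Fin m) K) ∈ N := fun j => by
    have := sq_prod_smul_derivation_eq_zero D θ hT0 hT hD0 b (X j)
    rwa [mkDerivation_X, ← map_smul, Submodule.mkQ_apply, Submodule.Quotient.mk_eq_zero] at this
  choose A hA using fun j => (Submodule.mem_span_range_iff_exists_fun _).mp (hmem j)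
  have hmul : Matrix.of A * jacobian F = U • (1 : Matrix (Fin m) (Fin m) _) := by
    ext1 i j
    have := congrFun (hA i) j
    simpa [Matrix.mul_apply, Finset.sum_apply, Matrix.one_apply, Pi.single_apply, eq_comm]
      using this
  refine ⟨(Matrix.of A).det, ?_⟩
  rw [mul_comm, ← Matrix.det_mul, hmul, Matrix.det_smul, Matrix.det_one, mul_one, Fintype.card_fin]

end Jacobian

section Generators

lemma algebraicIndependent_sub_algebraMap {R A ι : Type*} [CommRing R] [CommRing A] [Algebra R A]
    {x : ι → A} (hx : AlgebraicIndependent R x) (c : ι → R) :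
    AlgebraicIndependent R fun i => x i - algebraMap R A (c i) := by
  rw [algebraicIndependent_iff_injective_aeval] at hx ⊢
  let τ : MvPolynomial ι R →ₐ[R] MvPolynomial ι R := aeval fun i => X i - C (c i)
  let τ' : MvPolynomial ι R →ₐ[R] MvPolynomial ι R := aeval fun i => X i + C (c i)
  have hτ : τ'.comp τ = AlgHom.id R _ := by
    refine MvPolynomial.algHom_ext fun i => ?_
    simp [τ, τ']
  have h : aeval (fun i => x i - algebraMap R A (c i)) = (aeval x).comp τ := by
    refine MvPolynomial.algHom_ext fun i => ?_
    simp [τ]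
  rw [h, AlgHom.coe_comp]
  exact hx.comp (Function.LeftInverse.injective (g := τ') fun p => DFunLike.congr_fun hτ p)

lemma adjoin_sub_algebraMap_eq {R A ι : Type*} [CommRing R] [CommRing A] [Algebra R A]
    (x : ι → A) (c : ι → R) :
    Algebra.adjoin R (Set.range fun i => x i - algebraMap R A (c i)) =
      Algebra.adjoin R (Set.range x) := by
  apply le_antisymm <;> refine Algebra.adjoin_le ?_ <;> rintro _ ⟨i, rfl⟩
  · exact sub_mem (Algebra.subset_adjoin ⟨i, rfl⟩) (Subalgebra.algebraMap_mem _ _)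
  · rw [← sub_add_cancel (x i) (algebraMap R A (c i))]
    exact add_mem (Algebra.subset_adjoin ⟨i, rfl⟩) (Subalgebra.algebraMap_mem _ _)

/-- A polynomial subalgebra has algebraically independent generators without constant term. -/
lemma IsPolynomialRing.exists_generators {σ : Type*} {A : Subalgebra K (MvPolynomial σ K)}
    (h : IsPolynomialRing A) :
    ∃ (m : ℕ) (f : Fin m → MvPolynomial σ K), AlgebraicIndependent K f ∧
      (∀ i, constantCoeff (f i) = 0) ∧ Algebra.adjoin K (Set.range f) = A := by
  obtain ⟨m, ⟨e⟩⟩ := h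
  let φ : MvPolynomial (Fin m) K →ₐ[K] MvPolynomial σ K := A.val.comp e
  have hφ : Function.Injective φ := Subtype.val_injective.comp e.injective
  have hx : AlgebraicIndependent K fun i => φ (X i) :=
    (algebraicIndependent_X (Fin m) K).map' hφ
  refine ⟨m, fun i => φ (X i) - algebraMap K _ (constantCoeff (φ (X i))),
    algebraicIndependent_sub_algebraMap hx _, fun i => by simp [algebraMap_eq], ?_⟩
  rw [adjoin_sub_algebraMap_eq, Algebra.adjoin_range_eq_range_aeval]
  have : aeval (fun i => φ (X i)) = φ := MvPolynomial.algHom_ext fun i => by simp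
  rw [this]
  ext p
  constructor
  · rintro ⟨q, rfl⟩
    exact (e q).2
  · intro hp
    exact ⟨e.symm ⟨p, hp⟩, by simp [φ]⟩

end Generators

section Orbit

variable {W : Subgroup ((Fin n → K) ≃ₗ[K] (Fin n → K))}

/-- The product of the monic linear polynomials at the translates of `s` has invariant
coefficients. -/
lemma exists_map_eq_orbit_prod [Fintype W] (s : MvPolynomial (Fin n) K) :
    ∃ q : Polynomial (invariantsAlg W), q.Monic ∧ q.map (invariantsAlg W).val.toRingHom =
      ∏ w : W, (Polynomial.X -
        Polynomial.C (polyAct (w : (Fin n → K) ≃ₗ[K] (Fin n → K)) s)) := by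
  set P := ∏ w : W, (Polynomial.X -
    Polynomial.C (polyAct (w : (Fin n → K) ≃ₗ[K] (Fin n → K)) s)) with hP
  have hinv : ∀ g ∈ W, P.map (polyAct g).toRingHom = P := by
    intro g hg
    rw [hP, Polynomial.map_prod,
      ← Equiv.prod_comp (Equiv.mulRight (⟨g, hg⟩ : W)) fun w : W => Polynomial.X -
        Polynomial.C (polyAct (w : (Fin n → K) ≃ₗ[K] (Fin n → K)) s)]
    exact Finset.prod_congr rfl fun w _ => by simp [polyAct_polyAct]
  have hmem : P ∈ Polynomial.lifts (invariantsAlg W).val.toRingHom := by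
    rw [Polynomial.lifts_iff_coeff_lifts]
    exact fun k => ⟨⟨P.coeff k, fun g hg => (Polynomial.coeff_map _ k).symm.trans
      (congrArg (Polynomial.coeff · k) (hinv g hg))⟩, rfl⟩
  obtain ⟨q, hq, -, hm⟩ := Polynomial.lifts_and_natDegree_eq_and_monic hmem
    (Polynomial.monic_prod_of_monic _ _ fun w _ => Polynomial.monic_X_sub_C _)
  exact ⟨q, hm, hq⟩

lemma isIntegral_invariantsAlg [Finite W] :
    Algebra.IsIntegral (invariantsAlg W) (MvPolynomial (Fin n) K) := by
  have := Fintype.ofFinite W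
  refine ⟨fun s => ?_⟩
  obtain ⟨q, hm, hq⟩ := exists_map_eq_orbit_prod (W := W) s
  refine ⟨q, hm, ?_⟩
  change Polynomial.eval₂ (invariantsAlg W).val.toRingHom s q = 0
  rw [← Polynomial.eval_map, hq, Polynomial.eval_prod]
  exact Finset.prod_eq_zero (Finset.mem_univ (1 : W)) (by simp [polyAct_one])

lemma isTranscendenceBasis_of_adjoin_eq [Finite W] {ι : Type} {f : ι → MvPolynomial (Fin n) K}
    (hf : AlgebraicIndependent K f) (h : Algebra.adjoin K (Set.range f) = invariantsAlg W) :
    IsTranscendenceBasis K f := by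
  rw [hf.isTranscendenceBasis_iff_isAlgebraic, h]
  have := isIntegral_invariantsAlg (W := W)
  infer_instance

/-- If modulo a prime ideal an automorphism fixes the `W`-invariants, then it agrees with an
element of `W` modulo this ideal. -/
lemma exists_polyAct_sub_mem [Infinite K] [Finite W]
    (Q : Ideal (MvPolynomial (Fin n) K)) [Q.IsPrime]
    {g : (Fin n → K) ≃ₗ[K] (Fin n → K)} (hg : ∀ b ∈ invariantsAlg W, polyAct g b - b ∈ Q) :
    ∃ w ∈ W, ∀ s, polyAct g s - polyAct w s ∈ Q := by
  have := Fintype.ofFinite W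
  have hcover : ∀ s, ∃ w : W,
      polyAct g s - polyAct (w : (Fin n → K) ≃ₗ[K] (Fin n → K)) s ∈ Q := by
    intro s
    obtain ⟨q, -, hq⟩ := exists_map_eq_orbit_prod (W := W) s
    have h0 : Polynomial.eval s (q.map (invariantsAlg W).val.toRingHom) = 0 := by
      rw [hq, Polynomial.eval_prod]
      exact Finset.prod_eq_zero (Finset.mem_univ (1 : W)) (by simp [polyAct_one])
    have h1 : Polynomial.eval (polyAct g s) (q.map (invariantsAlg W).val.toRingHom) ∈ Q := by
      have h2 := congrArg (polyAct g) h0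
      rw [Polynomial.eval_map, Polynomial.eval₂_eq_sum_range, map_sum, map_zero] at h2
      rw [Polynomial.eval_map, Polynomial.eval₂_eq_sum_range, ← neg_mem_iff, ← zero_sub, ← h2,
        ← Finset.sum_sub_distrib]
      refine Q.sum_mem fun i _ => ?_
      rw [map_mul, map_pow, ← sub_mul]
      exact Q.mul_mem_right _ (hg _ (q.coeff i).2)
    rw [hq, Polynomial.eval_prod, Ideal.IsPrime.prod_mem_iff] at h1
    obtain ⟨w, -, hw⟩ := h1
    exact ⟨w, by simpa using hw⟩
  obtain ⟨w, hw⟩ := Subspace.exists_eq_top_of_iUnion_eq_univ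
    (p := fun w : W => (Q.restrictScalars K).comap ((polyAct g).toLinearMap -
      (polyAct (w : (Fin n → K) ≃ₗ[K] (Fin n → K))).toLinearMap)) (by
    refine Set.eq_univ_of_forall fun s => Set.mem_iUnion.mpr ?_
    obtain ⟨w, hw⟩ := hcover s
    exact ⟨w, hw⟩)
  exact ⟨w, w.2, fun s => by
    have : s ∈ (⊤ : Submodule K (MvPolynomial (Fin n) K)) := Submodule.mem_top
    rw [← hw] at this
    exact this⟩

end Orbit

section ReflectionSubgroup

lemma eval_polyAct (g : (Fin n → K) ≃ₗ[K] (Fin n → K)) (v : Fin n → K)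
    (p : MvPolynomial (Fin n) K) : eval v (polyAct g p) = eval (g v) p := by
  have : (aeval v).comp (polyAct g) = aeval (R := K) (g v) := by
    refine MvPolynomial.algHom_ext fun i => ?_
    rw [AlgHom.comp_apply, polyAct_X, aeval_X, ← glMatrix_mulVec]
    simp [Matrix.mulVec, dotProduct]
  simpa [aeval_eq_eval] using DFunLike.congr_fun this p

/-- An element of finite order moving all linear forms by multiples of one non-unit polynomial is a
reflection. -/
lemma isPseudoReflection_of_dvd {a : (Fin n → K) ≃ₗ[K] (Fin n → K)} (ha : IsOfFinOrder a)
    (ha1 : a ≠ 1) {q : MvPolynomial (Fin n) K} (hq : ¬ IsUnit q)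
    (h : ∀ i, q ∣ polyAct a (X i) - X i) : IsPseudoReflection a := by
  set L : Fin n → MvPolynomial (Fin n) K := fun i => polyAct a (X i) - X i
  have hL : ∀ i v, eval v (L i) = a v i - v i := fun i v => by simp [L, eval_polyAct]
  have hLh : ∀ i, (L i).IsHomogeneous 1 := fun i =>
    (polyAct_isHomogeneous a (isHomogeneous_X K i)).sub (isHomogeneous_X K i)
  obtain ⟨v₀, hv₀⟩ : ∃ v, a v ≠ v := by
    by_contra! hv
    exact ha1 (LinearEquiv.ext hv)
  obtain ⟨i₀, hi₀⟩ : ∃ i, a v₀ i ≠ v₀ i := Function.ne_iff.mp hv₀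
  have hL0 : L i₀ ≠ 0 := fun h0 => hi₀ (by
    have := hL i₀ v₀
    rw [h0, map_zero] at this
    exact (sub_eq_zero.mp this.symm))
  obtain ⟨t, ht⟩ := h i₀
  have hqt : q ≠ 0 ∧ t ≠ 0 := by
    rw [← mul_ne_zero_iff, ← ht]
    exact hL0
  have hdeg := totalDegree_mul_of_isDomain hqt.1 hqt.2
  rw [← ht, (hLh i₀).totalDegree hL0] at hdeg
  have hq1 : q.totalDegree ≠ 0 := fun h0 => hq (by
    rw [totalDegree_eq_zero_iff_eq_C] at h0
    rw [h0]
    refine IsUnit.map C (IsUnit.mk0 _ fun h1 => hqt.1 ?_)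
    rw [h0, h1, C_0])
  have ht0 : t.totalDegree = 0 := by omega
  rw [totalDegree_eq_zero_iff_eq_C] at ht0
  have hc : coeff 0 t ≠ 0 := fun h0 => hqt.2 (by rw [ht0, h0, C_0])
  have hdvd : L i₀ ∣ q := ⟨C (coeff 0 t)⁻¹, by
    change q = (polyAct a (X i₀) - X i₀) * _
    have htc : t * C (coeff 0 t)⁻¹ = 1 := by
      conv_lhs => rw [ht0, coeff_C, if_pos rfl]
      rw [← C_mul, mul_inv_cancel₀ hc, C_1]
    rw [ht, mul_assoc, htc, mul_one]⟩
  have hτ : ∀ i, ∃ τ : K, L i = L i₀ * C τ := fun i => by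
    obtain ⟨r, hr⟩ := hdvd.trans (h i)
    change L i = _ at hr
    by_cases hi : L i = 0
    · exact ⟨0, by rw [hi, C_0, mul_zero]⟩
    · have hr0 : r ≠ 0 := fun h0 => hi (by rw [hr, h0, mul_zero])
      have hdeg' := totalDegree_mul_of_isDomain hL0 hr0
      rw [← hr, (hLh i).totalDegree hi, (hLh i₀).totalDegree hL0] at hdeg'
      have hr1 : r.totalDegree = 0 := by omega
      rw [totalDegree_eq_zero_iff_eq_C] at hr1
      exact ⟨coeff 0 r, by rw [← hr1, hr]⟩
  choose τ hτ using hτ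
  let φ : Module.Dual K (Fin n → K) :=
    LinearMap.proj i₀ ∘ₗ (a.toLinearMap - LinearMap.id)
  have hφ : ∀ v, φ v = a v i₀ - v i₀ := fun v => rfl
  refine ⟨ha1, ha, LinearMap.ker φ, ?_, fun v hv => ?_⟩
  · rw [Module.Dual.finrank_ker_add_one_of_ne_zero fun h0 => ?_, Module.finrank_fin_fun]
    have := hφ v₀
    rw [h0, LinearMap.zero_apply] at this
    exact hi₀ (sub_eq_zero.mp this.symm)
  · rw [LinearMap.mem_ker, hφ] at hv
    ext i
    have := hL i v
    rw [hτ i, map_mul, hL i₀, hv, zero_mul] at this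
    exact sub_eq_zero.mp this.symm

variable {W : Subgroup ((Fin n → K) ≃ₗ[K] (Fin n → K))}

/-- The subgroup generated by the reflections contained in `W`. -/
def reflectionSubgroup (W : Subgroup ((Fin n → K) ≃ₗ[K] (Fin n → K))) :
    Subgroup ((Fin n → K) ≃ₗ[K] (Fin n → K)) :=
  Subgroup.closure {g | g ∈ W ∧ IsPseudoReflection g}

lemma reflectionSubgroup_le : reflectionSubgroup W ≤ W :=
  (Subgroup.closure_le W).mpr fun _ hg => hg.1

lemma closure_reflectionSubgroup :
    Subgroup.closure {g | g ∈ reflectionSubgroup W ∧ IsPseudoReflection g} =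
      reflectionSubgroup W :=
  le_antisymm ((Subgroup.closure_le _).mpr fun _ hg => hg.1)
    (Subgroup.closure_mono fun _ hg => ⟨Subgroup.subset_closure hg, hg.2⟩)

/-- An element of `W` acting trivially on the invariants of the reflection subgroup modulo a
principal prime lies in the reflection subgroup. -/
lemma mem_reflectionSubgroup_of_dvd [Infinite K] [Finite W] {w : (Fin n → K) ≃ₗ[K] (Fin n → K)}
    (hw : w ∈ W) {q : MvPolynomial (Fin n) K} (hq : (Ideal.span {q}).IsPrime)
    (h : ∀ b ∈ invariantsAlg (reflectionSubgroup W), q ∣ polyAct w b - b) :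
    w ∈ reflectionSubgroup W := by
  have : Finite (reflectionSubgroup W) :=
    Finite.of_injective _ (Subgroup.inclusion_injective (reflectionSubgroup_le (W := W)))
  obtain ⟨w', hw', hs⟩ := exists_polyAct_sub_mem (W := reflectionSubgroup W) (Ideal.span {q})
    fun b hb => Ideal.mem_span_singleton.mpr (h b hb)
  by_cases ha1 : w * w'⁻¹ = 1
  · rwa [mul_inv_eq_one.mp ha1]
  have haW : w * w'⁻¹ ∈ W := W.mul_mem hw (W.inv_mem (reflectionSubgroup_le hw'))
  have hfin : IsOfFinOrder (w * w'⁻¹) :=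
    W.subtype.isOfFinOrder (isOfFinOrder_of_finite (⟨w * w'⁻¹, haW⟩ : W))
  have hq' : ¬ IsUnit (polyAct w'⁻¹ q) := fun hu => hq.ne_top (by
    have := hu.map (polyAct w')
    rw [polyAct_polyAct, inv_mul_cancel, polyAct_one] at this
    exact Ideal.span_singleton_eq_top.mpr this)
  have hdvd : ∀ i, polyAct w'⁻¹ q ∣ polyAct (w * w'⁻¹) (X i) - X i := fun i => by
    have := map_dvd (polyAct w'⁻¹) (Ideal.mem_span_singleton.mp (hs (X i)))
    rwa [map_sub, polyAct_inv_polyAct, polyAct_polyAct] at this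
  have := Subgroup.mul_mem _ (Subgroup.subset_closure
    ⟨haW, isPseudoReflection_of_dvd hfin ha1 hq' hdvd⟩ : w * w'⁻¹ ∈ reflectionSubgroup W) hw'
  rwa [inv_mul_cancel_right] at this

lemma IsPseudoReflection.conj {s : (Fin n → K) ≃ₗ[K] (Fin n → K)} (hs : IsPseudoReflection s)
    (g : (Fin n → K) ≃ₗ[K] (Fin n → K)) : IsPseudoReflection (g * s * g⁻¹) := by
  obtain ⟨h1, h2, H, hH, hfix⟩ := hs
  refine ⟨fun h => h1 (conj_eq_one_iff.mp h), (MulAut.conj g).toMonoidHom.isOfFinOrder h2,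
    H.map g.toLinearMap, ?_, ?_⟩
  · exact (congrArg (· + 1) (LinearEquiv.finrank_map_eq g H)).trans hH
  · rintro _ ⟨v, hv, rfl⟩
    have h3 : g⁻¹ (g v) = v := g.symm_apply_apply v
    change g (s (g⁻¹ (g v))) = g v
    rw [h3, hfix v hv]

lemma conj_mem_reflectionSubgroup {g h : (Fin n → K) ≃ₗ[K] (Fin n → K)} (hg : g ∈ W)
    (hh : h ∈ reflectionSubgroup W) : g * h * g⁻¹ ∈ reflectionSubgroup W := by
  have : reflectionSubgroup W ≤ (reflectionSubgroup W).comap (MulAut.conj g).toMonoidHom :=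
    (Subgroup.closure_le _).mpr fun s hs => Subgroup.subset_closure
      ⟨W.mul_mem (W.mul_mem hg hs.1) (W.inv_mem hg), hs.2.conj g⟩
  exact this hh

lemma polyAct_mem_invariantsAlg_reflectionSubgroup {g : (Fin n → K) ≃ₗ[K] (Fin n → K)} (hg : g ∈ W)
    {p : MvPolynomial (Fin n) K} (hp : p ∈ invariantsAlg (reflectionSubgroup W)) :
    polyAct g p ∈ invariantsAlg (reflectionSubgroup W) := by
  intro h hh
  rw [polyAct_polyAct, ← inv_mul_cancel_right (g * h) g, ← polyAct_polyAct,
    hp _ (conj_mem_reflectionSubgroup hg hh)]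

lemma invariantsAlg_le_invariantsAlg_reflectionSubgroup :
    invariantsAlg W ≤ invariantsAlg (reflectionSubgroup W) := fun _ hp g hg =>
  hp g (reflectionSubgroup_le hg)

end ReflectionSubgroup

section Jacobian

lemma constantCoeff_aeval_of_constantCoeff_eq_zero {σ ι R : Type*} [CommSemiring R]
    {g : ι → MvPolynomial σ R} (hg : ∀ i, constantCoeff (g i) = 0) (p : MvPolynomial ι R) :
    constantCoeff (aeval g p) = constantCoeff p := by
  have : constantCoeff.comp (aeval g).toRingHom = (constantCoeff : MvPolynomial ι R →+* R) :=
    ringHom_ext (by simp) (by simp [hg])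
  exact DFunLike.congr_fun this p

/-- If the Jacobian matrix of `F` is invertible at the origin, then every polynomial is an affine
combination of the `F i` up to terms of order at least two. -/
lemma exists_affine_combination {m : ℕ} {F : Fin m → MvPolynomial (Fin m) K}
    (hF : ∀ i, constantCoeff (F i) = 0) (hdet : constantCoeff (jacobian F).det ≠ 0)
    (p : MvPolynomial (Fin m) K) :
    ∃ (c : K) (t : Fin m → K), p - C c - ∑ i, C (t i) * F i ∈ idealOfVars (Fin m) K ^ 2 := by
  set L : Matrix (Fin m) (Fin m) K := (jacobian F).map constantCoeff with hL
  have hLdet : IsUnit L.det := by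
    rw [hL, ← RingHom.mapMatrix_apply, ← RingHom.map_det]
    exact IsUnit.mk0 _ hdet
  set q : Fin m → K := fun j => constantCoeff (pderiv j p) with hq
  have ht : Matrix.vecMul (Matrix.vecMul q L⁻¹) L = q := by
    rw [Matrix.vecMul_vecMul, Matrix.nonsing_inv_mul _ hLdet, Matrix.vecMul_one]
  set t := Matrix.vecMul q L⁻¹
  refine ⟨constantCoeff p, t, ?_⟩
  set r := p - C (constantCoeff p) - ∑ i, C (t i) * F i with hr
  have hr0 : constantCoeff r = 0 := by simp [hr, hF]
  have hr1 : ∀ j, constantCoeff (pderiv j r) = 0 := fun j => by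
    have := congrFun ht j
    simp only [Matrix.vecMul, dotProduct, hL, hq, jacobian, Matrix.map_apply, Matrix.of_apply]
      at this
    simp only [hr, map_sub, map_sum, pderiv_C, sub_zero, pderiv_C_mul]
    rw [← this, sub_eq_zero]
    exact Finset.sum_congr rfl fun i _ => by simp
  rw [mem_pow_idealOfVars_iff']
  intro x hx
  obtain h | h : x.degree = 0 ∨ x.degree = 1 := by omega
  · rw [(Finsupp.degree_eq_zero_iff x).mp h]
    simpa [constantCoeff_eq] using hr0
  · obtain ⟨j, rfl⟩ : x ∈ Set.range fun j => Finsupp.single j 1 := by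
      rwa [Finsupp.range_single_one]
    have := hr1 j
    rw [constantCoeff_eq, coeff_pderiv] at this
    simpa using this

/-- A graded subalgebra generated by elements `g` without constant term is contained in any graded
subalgebra containing polynomials in `g` whose Jacobian is invertible at the origin. -/
lemma adjoin_le_of_constantCoeff_det_jacobian_ne_zero {σ : Type*} {m : ℕ}
    {A B : Subalgebra K (MvPolynomial σ K)}
    (hA : ∀ p ∈ A, ∀ d, homogeneousComponent d p ∈ A) {g : Fin m → MvPolynomial σ K}
    (hg : ∀ i, constantCoeff (g i) = 0) (hgB : Algebra.adjoin K (Set.range g) = B)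
    {F : Fin m → MvPolynomial (Fin m) K} (hF : ∀ i, constantCoeff (F i) = 0)
    (hFA : ∀ i, aeval g (F i) ∈ A) (hdet : constantCoeff (jacobian F).det ≠ 0) : B ≤ A := by
  have hφ : ∀ p, p ∈ B ↔ ∃ q, aeval g q = p := fun p => by
    rw [← hgB, Algebra.adjoin_range_eq_range_aeval]
    rfl
  have key : ∀ d, ∀ p ∈ B, homogeneousComponent d p ∈ A := by
    intro d
    induction d using Nat.strong_induction_on with
    | _ d ih =>
    intro p hp
    obtain ⟨q, rfl⟩ := (hφ p).mp hp
    obtain ⟨c, t, hr⟩ := exists_affine_combination hF hdet q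
    set r := q - C c - ∑ i, C (t i) * F i with hrdef
    have hq : q = r + C c + ∑ i, C (t i) * F i := by rw [hrdef]; ring
    have hrA : homogeneousComponent d (aeval g r) ∈ A := by
      rw [sq] at hr
      refine Submodule.mul_induction_on hr (fun a ha b hb => ?_) fun a b ha hb => ?_
      · have h0 : ∀ a ∈ idealOfVars (Fin m) K,
            homogeneousComponent 0 (aeval g a) = 0 := fun a ha => by
          rw [homogeneousComponent_zero, ← constantCoeff_eq,
            constantCoeff_aeval_of_constantCoeff_eq_zero hg, constantCoeff_eq]
          rw [← pow_one (idealOfVars (Fin m) K), mem_pow_idealOfVars_iff'] at ha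
          rw [ha 0 (by simp), C_0]
        rw [map_mul, ← sum_homogeneousComponent (aeval g b), Finset.mul_sum, map_sum]
        refine A.sum_mem fun j _ => ?_
        rw [homogeneousComponent_mul_of_isHomogeneous (homogeneousComponent_isHomogeneous j _)]
        split_ifs with hj
        · obtain rfl | hj0 := Nat.eq_zero_or_pos j
          · rw [h0 b hb, mul_zero]
            exact A.zero_mem
          obtain rfl | hjd := hj.eq_or_lt
          · rw [Nat.sub_self, h0 a ha, zero_mul]
            exact A.zero_mem
          exact A.mul_mem (ih _ (by omega) _ ((hφ _).mpr ⟨a, rfl⟩))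
            (ih _ hjd _ ((hφ _).mpr ⟨b, rfl⟩))
        · exact A.zero_mem
      · rw [map_add, map_add]
        exact A.add_mem ha hb
    rw [hq, map_add, map_add, map_add, map_add]
    refine A.add_mem (A.add_mem hrA ?_) (hA _ ?_ d)
    · refine hA _ ?_ d
      rw [algHom_C]
      exact A.algebraMap_mem c
    · rw [map_sum]
      refine A.sum_mem fun i _ => ?_
      rw [map_mul, algHom_C]
      exact A.mul_mem (A.algebraMap_mem _) (hFA i)
  intro p hp
  rw [← sum_homogeneousComponent p]
  exact A.sum_mem fun d _ => key d p hp

end Jacobian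

section Converse

variable {W : Subgroup ((Fin n → K) ≃ₗ[K] (Fin n → K))}

lemma det_jacobian_isUnit [CharZero K] [Finite W] {m : ℕ} {g : Fin m → MvPolynomial (Fin n) K}
    (hg : AlgebraicIndependent K g)
    (hgW : Algebra.adjoin K (Set.range g) = invariantsAlg (reflectionSubgroup W))
    {F : Fin m → MvPolynomial (Fin m) K}
    (hF : Algebra.adjoin K (Set.range fun i => aeval g (F i)) = invariantsAlg W) :
    IsUnit (aeval g (jacobian F).det) := by
  classical
  have := Fintype.ofFinite W
  have hinj : Function.Injective (aeval g : MvPolynomial (Fin m) K →ₐ[K] _) :=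
    algebraicIndependent_iff_injective_aeval.mp hg
  have hφ : ∀ p, p ∈ invariantsAlg (reflectionSubgroup W) ↔ ∃ q, aeval g q = p := fun p => by
    rw [← hgW, Algebra.adjoin_range_eq_range_aeval]
    rfl
  have hθ : ∀ w : W, ∃ θ : MvPolynomial (Fin m) K →ₐ[K] MvPolynomial (Fin m) K,
      ∀ p, aeval g (θ p) = polyAct (w : (Fin n → K) ≃ₗ[K] (Fin n → K)) (aeval g p) := by
    intro w
    choose y hy using fun i => (hφ _).mp (polyAct_mem_invariantsAlg_reflectionSubgroup w.2
      ((hφ (g i)).mpr ⟨X i, aeval_X _ _⟩))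
    refine ⟨aeval y, DFunLike.congr_fun (f := (aeval g).comp (aeval y))
      (g := (polyAct (w : (Fin n → K) ≃ₗ[K] (Fin n → K))).comp (aeval g)) ?_⟩
    exact MvPolynomial.algHom_ext fun i => by
      rw [AlgHom.comp_apply, AlgHom.comp_apply, aeval_X, aeval_X, hy]
  choose θ hθ using hθ
  let T : Finset W := {w | (w : (Fin n → K) ≃ₗ[K] (Fin n → K)) ∈ reflectionSubgroup W}
  have hT0 : T.Nonempty := ⟨1, by simp [T]⟩
  have hT : ∀ w ∈ T, ∀ x, θ w x = x := fun w hw x => hinj (by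
    rw [hθ]
    exact (hφ _).mpr ⟨x, rfl⟩ _ (by simpa [T] using hw))
  have hsum : ∀ x, ∃ y : MvPolynomial (Fin m) K, ∑ w, θ w x = aeval F y := fun x => by
    have h1 := translateSum_mem (W := W) (aeval g x)
    rw [← hF, Algebra.adjoin_range_eq_range_aeval] at h1
    obtain ⟨y, hy⟩ := h1
    refine ⟨y, hinj ?_⟩
    rw [map_sum, Finset.sum_congr rfl fun w _ => hθ w x, ← translateSum_apply, ← hy]
    exact DFunLike.congr_fun (f := aeval fun i => aeval g (F i)) (g := (aeval g).comp (aeval F))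
      (MvPolynomial.algHom_ext fun i => by simp) y
  have hfactor : ∀ q, (Ideal.span {q}).IsPrime → ¬ q ∣ aeval g (jacobian F).det := by
    intro q hq hdvd
    have hb : ∀ w : W, ∃ b : MvPolynomial (Fin m) K, w ∉ T → ¬ q ∣ aeval g (b - θ w b) := by
      intro w
      by_cases hw : w ∈ T
      · exact ⟨0, fun h => absurd hw h⟩
      · have h1 : ¬ ∀ b ∈ invariantsAlg (reflectionSubgroup W),
            q ∣ polyAct (w : (Fin n → K) ≃ₗ[K] (Fin n → K)) b - b := fun h => hw (by
          simpa [T] using mem_reflectionSubgroup_of_dvd w.2 hq h)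
        push Not at h1
        obtain ⟨p, hp, hqp⟩ := h1
        obtain ⟨b, rfl⟩ := (hφ p).mp hp
        refine ⟨b, fun _ h => hqp ?_⟩
        rwa [map_sub, hθ, dvd_sub_comm] at h
    choose b hb using hb
    have h1 := hdvd.trans (map_dvd (aeval g) (det_jacobian_dvd θ hT0 hT hsum b))
    rw [map_pow, map_pow, map_prod, ← Ideal.mem_span_singleton] at h1
    obtain ⟨w, hw, h2⟩ := Ideal.IsPrime.prod_mem_iff.mp
      (hq.mem_of_pow_mem _ (hq.mem_of_pow_mem _ h1))
    exact hb w (Finset.mem_compl.mp hw) (Ideal.mem_span_singleton.mp h2)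
  by_contra hunit
  by_cases h0 : aeval g (jacobian F).det = 0
  · refine hfactor 0 ?_ (by rw [h0])
    rw [Ideal.span_singleton_eq_bot.mpr rfl]
    exact Ideal.isPrime_bot
  · obtain ⟨q, hq, hdvd⟩ := WfDvdMonoid.exists_irreducible_factor hunit h0
    exact hfactor q ((Ideal.span_singleton_prime hq.ne_zero).mpr hq.prime) hdvd

/-- A finite linear group with polynomial ring of invariants is generated by its reflections. -/
theorem reflectionSubgroup_eq_of_isPolynomialRing [CharZero K] [Finite W]
    (h : IsPolynomialRing (invariantsAlg W)) : reflectionSubgroup W = W := by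
  have : Finite (reflectionSubgroup W) :=
    Finite.of_injective _ (Subgroup.inclusion_injective (reflectionSubgroup_le (W := W)))
  obtain ⟨m, f, hf, hf0, hfW⟩ := h.exists_generators
  obtain ⟨m', g, hg, hg0, hgW⟩ :=
    (isPolynomialRing_of_closure_eq (closure_reflectionSubgroup (W := W))).exists_generators
  obtain rfl : m = m' := by
    simpa using (isTranscendenceBasis_of_adjoin_eq hf hfW).cardinalMk_eq
      (isTranscendenceBasis_of_adjoin_eq hg hgW)
  have hF : ∀ i, ∃ F : MvPolynomial (Fin m) K, aeval g F = f i := fun i => by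
    have h1 : f i ∈ invariantsAlg (reflectionSubgroup W) :=
      invariantsAlg_le_invariantsAlg_reflectionSubgroup
        (hfW ▸ Algebra.subset_adjoin ⟨i, rfl⟩)
    rwa [← hgW, Algebra.adjoin_range_eq_range_aeval] at h1
  choose F hF using hF
  obtain rfl : f = fun i => aeval g (F i) := funext fun i => (hF i).symm
  have hdet : constantCoeff (jacobian F).det ≠ 0 := by
    rw [← constantCoeff_aeval_of_constantCoeff_eq_zero hg0]
    exact ((det_jacobian_isUnit hg hgW hfW).map constantCoeff).ne_zero
  have hle : invariantsAlg (reflectionSubgroup W) ≤ invariantsAlg W :=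
    adjoin_le_of_constantCoeff_det_jacobian_ne_zero
      (fun _ hp => homogeneousComponent_mem_invariantsAlg hp) hg0 hgW
      (fun i => by rw [← constantCoeff_aeval_of_constantCoeff_eq_zero hg0, hf0])
      (fun i => hfW ▸ Algebra.subset_adjoin ⟨i, rfl⟩) hdet
  refine le_antisymm reflectionSubgroup_le fun w hw =>
    mem_reflectionSubgroup_of_dvd hw (q := 0) ?_ fun b hb => ?_
  · rw [Ideal.span_singleton_eq_bot.mpr rfl]
    exact Ideal.isPrime_bot
  · rw [hle hb w hw, sub_self]

end Converse

/-- **Shephard–Todd–Chevalley.** Over a field of characteristic zero, a finite linear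
group `W` has polynomial ring of invariants if and only if it is generated by
(pseudo-)reflections. -/
theorem shephard_todd_chevalley [CharZero K]
    (W : Subgroup ((Fin n → K) ≃ₗ[K] (Fin n → K))) [Finite W] :
    IsPolynomialRing (invariantsAlg W) ↔
      Subgroup.closure {g | g ∈ W ∧ IsPseudoReflection g} = W :=
  ⟨reflectionSubgroup_eq_of_isPolynomialRing, isPolynomialRing_of_closure_eq⟩
end

section
/- Let (W,S) be a Coxeter system and M a monoid. If f : S → M satisfies the braid relations, i.e., f(s)f(t)f(s)⋯ = f(t)f(s)f(t)⋯ (m_{st} factors on each side) for all s ≠ t with m_{st} < ∞, then there is a unique map F : W → M such that F(w) = f(s_1)⋯f(s_k) whenever w = s_1⋯s_k is a reduced expression. -/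
/-- The alternating product `f s * f t * f s * ⋯` with `m` factors. -/
def braidProd {B : Type*} {M : Type*} [Monoid M] (f : B → M) (s t : B) (m : ℕ) : M :=
  ((List.range m).map (fun i => if i % 2 = 0 then f s else f t)).prod

open Classical in
/-- The operator `(x, ε) ↦ (s x s⁻¹, ε + [x = s])` on signed elements of a group. -/
noncomputable def signedConj {W : Type*} [Group W] (s : W) : Function.End (W × ZMod 2) :=
  fun p => (s * p.1 * s⁻¹, p.2 + if p.1 = s then 1 else 0)

open Classical in
theorem signedConj_mul_pow_apply {W : Type*} [Group W] {s t : W} (hs : s * s = 1)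
    (ht : t * t = 1) (n : ℕ) (x : W) (ε : ZMod 2) :
    ((signedConj s * signedConj t) ^ n) (x, ε) =
      ((s * t) ^ n * x * ((s * t) ^ n)⁻¹,
        ε + ∑ j ∈ Finset.range (2 * n), if x = (t * s) ^ j * t then 1 else 0) := by
  have hs' : s⁻¹ = s := inv_eq_of_mul_eq_one_right hs
  have ht' : t⁻¹ = t := inv_eq_of_mul_eq_one_right ht
  have hinv : (t * s) = (s * t)⁻¹ := by rw [mul_inv_rev, hs', ht']
  induction n with
  | zero => simp; rfl
  | succ n ih =>
    have hcomm : (s * t) ^ n * t = t * ((s * t) ^ n)⁻¹ := by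
      have h : SemiconjBy t (s * t) (t * s) := by simp [SemiconjBy, mul_assoc]
      have h2 := (h.pow_right n).eq
      rw [hinv, inv_pow] at h2
      rw [eq_mul_inv_iff_mul_eq, mul_assoc, h2]
      simp
    have hcomm' : ((s * t) ^ n)⁻¹ * t = t * (s * t) ^ n := by
      rw [inv_mul_eq_iff_eq_mul, ← mul_assoc, hcomm]
      simp
    have h1 : (s * t) ^ n * x * ((s * t) ^ n)⁻¹ = t ↔ x = (t * s) ^ (2 * n) * t := by
      rw [mul_inv_eq_iff_eq_mul, ← eq_inv_mul_iff_mul_eq, ← hcomm', hinv, inv_pow, two_mul,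
        pow_add, mul_inv_rev, mul_assoc]
    have h2 : t * ((s * t) ^ n * x * ((s * t) ^ n)⁻¹) * t⁻¹ = s ↔
        x = (t * s) ^ (2 * n + 1) * t := by
      have e : (t * s) ^ (2 * n + 1) * t =
          ((s * t) ^ n)⁻¹ * (t * s * t) * (s * t) ^ n := by
        calc (t * s) ^ (2 * n + 1) * t = (t * s) ^ n * (t * s) * ((t * s) ^ n * t) := by
              rw [← mul_assoc, ← pow_succ, ← pow_add]; congr 2; omega
          _ = _ := by
              rw [hinv, inv_pow, hcomm', ← hinv]; simp only [mul_assoc]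
      rw [e]
      constructor
      · intro h
        generalize (s * t) ^ n = g at h ⊢
        rw [← h]
        calc x = g⁻¹ * (t * t * (g * x * g⁻¹) * (t⁻¹ * t)) * g := by rw [ht]; group
          _ = _ := by simp only [mul_assoc]
      · rintro rfl
        simp [ht', mul_assoc, ht]
        simp [← mul_assoc, ht]
    rw [pow_succ']
    change signedConj s (signedConj t (((signedConj s * signedConj t) ^ n) (x, ε))) = _
    rw [ih]
    simp only [signedConj, h1, h2]
    rw [show 2 * (n + 1) = 2 * n + 1 + 1 by ring, Finset.sum_range_succ, Finset.sum_range_succ]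
    refine Prod.ext ?_ ?_
    · simp [pow_succ', mul_assoc]
    · simp only [add_assoc]

namespace CoxeterSystem

variable {B W : Type*} [Group W] {M : CoxeterMatrix B} (cs : CoxeterSystem M W)

theorem isLiftable_signedConj : M.IsLiftable (fun i => signedConj (cs.simple i)) := by
  classical
  intro i j
  funext ⟨x, ε⟩
  rw [signedConj_mul_pow_apply (cs.simple_mul_simple_self i) (cs.simple_mul_simple_self j),
    cs.simple_mul_simple_pow, two_mul, Finset.sum_range_add]
  have h : ∀ k, (cs.simple j * cs.simple i) ^ (M i j + k) = (cs.simple j * cs.simple i) ^ k := by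
    intro k
    rw [pow_add, cs.simple_mul_simple_pow', one_mul]
  simp only [h, CharTwo.add_self_eq_zero]
  simp; rfl

open Classical in
theorem lift_signedConj_wordProd_apply (ω : List B) (x : W) (ε : ZMod 2) :
    cs.lift ⟨_, cs.isLiftable_signedConj⟩ (cs.wordProd ω) (x, ε) =
      (cs.wordProd ω * x * (cs.wordProd ω)⁻¹, ε + ((cs.rightInvSeq ω).count x : ZMod 2)) := by
  induction ω with
  | nil => simp; rfl
  | cons i ω ih =>
    rw [cs.wordProd_cons, map_mul, cs.lift_apply_simple]
    change signedConj (cs.simple i) (cs.lift ⟨_, cs.isLiftable_signedConj⟩ _ _) = _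
    rw [ih]
    have h : cs.wordProd ω * x * (cs.wordProd ω)⁻¹ = cs.simple i ↔
        (cs.wordProd ω)⁻¹ * cs.simple i * cs.wordProd ω = x := by
      constructor
      · intro h; rw [← h]; group
      · rintro rfl; group
    refine Prod.ext ?_ ?_
    · simp [signedConj, mul_assoc]
    · simp only [signedConj, rightInvSeq, List.count_cons, beq_iff_eq, h]
      push_cast
      rw [add_assoc]

open Classical in
/-- The parity of the number of occurrences of an element in the left inversion sequence of a word
depends only on the product of the word. -/
theorem count_leftInvSeq_eq_of_wordProd_eq {ω ω' : List B} (h : cs.wordProd ω = cs.wordProd ω')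
    (x : W) : ((cs.leftInvSeq ω).count x : ZMod 2) = (cs.leftInvSeq ω').count x := by
  have h1 := cs.lift_signedConj_wordProd_apply ω.reverse x 0
  have h2 := cs.lift_signedConj_wordProd_apply ω'.reverse x 0
  rw [cs.wordProd_reverse, h, ← cs.wordProd_reverse, h2] at h1
  simpa [rightInvSeq_reverse] using (congrArg Prod.snd h1).symm

theorem exists_isReduced_cons_of_isLeftDescent {w : W} {i : B} (h : cs.IsLeftDescent w i) :
    ∃ ω, cs.IsReduced (i :: ω) ∧ cs.wordProd (i :: ω) = w := by
  obtain ⟨ω, hω, hw⟩ := cs.exists_isReduced (cs.simple i * w)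
  have hp : cs.wordProd (i :: ω) = w := by rw [cs.wordProd_cons, ← hw]; simp
  refine ⟨ω, ?_, hp⟩
  rw [cs.isLeftDescent_iff] at h
  rw [IsReduced, hp, ← h, hw, hω.eq, List.length_cons]

/-- The exchange property, in terms of left inversion sequences. -/
theorem simple_mem_leftInvSeq {ω : List B} {i : B} (h : cs.IsLeftDescent (cs.wordProd ω) i) :
    cs.simple i ∈ cs.leftInvSeq ω := by
  classical
  obtain ⟨ω', hr, hp⟩ := cs.exists_isReduced_cons_of_isLeftDescent h
  have h1 := cs.count_leftInvSeq_eq_of_wordProd_eq hp (cs.simple i)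
  rw [List.count_eq_one_of_mem hr.nodup_leftInvSeq (by simp [leftInvSeq])] at h1
  by_contra hn
  rw [List.count_eq_zero_of_not_mem hn] at h1
  simp at h1

theorem leftInvSeq_append (a b : List B) :
    cs.leftInvSeq (a ++ b) =
      cs.leftInvSeq a ++ (cs.leftInvSeq b).map (MulAut.conj (cs.wordProd a)) := by
  induction a with
  | nil => simp
  | cons i a ih =>
    simp [leftInvSeq, ih, wordProd_cons, mul_assoc, Function.comp_def]

theorem exists_wordProd_eq_mul_of_mem_leftInvSeq {ω : List B} {r : W}
    (h : r ∈ cs.leftInvSeq ω) :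
    ∃ ω' : List B, ω'.length + 1 = ω.length ∧ cs.wordProd ω' = r * cs.wordProd ω := by
  obtain ⟨j, hj, rfl⟩ := List.mem_iff_getElem.mp h
  have hj' : j < ω.length := by simpa using hj
  refine ⟨ω.eraseIdx j, ?_, ?_⟩
  · rw [List.length_eraseIdx_of_lt hj']; omega
  · rw [← cs.getD_leftInvSeq_mul_wordProd, List.getD_eq_getElem _ _ hj]

end CoxeterSystem

namespace CoxeterMatrix

variable {B : Type*} (M : CoxeterMatrix B)

/-- A number `η` such that `η ^ 2` has order exactly `m` (infinite order if `m = 0`). -/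
noncomputable def halfRoot (m : ℕ) : ℂ :=
  if m = 0 then 2 else Complex.exp (2 * Real.pi * Complex.I / (2 * m : ℕ))

theorem halfRoot_ne_zero (m : ℕ) : halfRoot m ≠ 0 := by
  unfold halfRoot
  split_ifs
  · norm_num
  · exact Complex.exp_ne_zero _

theorem halfRoot_sq_pow_eq_one_iff (m k : ℕ) : (halfRoot m ^ 2) ^ k = 1 ↔ m ∣ k := by
  unfold halfRoot
  split_ifs with h
  · subst h
    rw [zero_dvd_iff]
    constructor
    · intro h
      norm_num at h
      by_contra hk
      have : (4 : ℕ) ^ k = 1 := by exact_mod_cast h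
      simp [hk] at this
    · rintro rfl; simp
  · have := (Complex.isPrimitiveRoot_exp (2 * m) (by omega)).pow (by omega) (rfl : 2 * m = 2 * m)
    exact this.pow_eq_one_iff_dvd k

theorem halfRoot_one : halfRoot 1 = -1 := by
  have h : (2 * Real.pi * Complex.I / (2 * 1 : ℕ) : ℂ) = Real.pi * Complex.I := by
    push_cast; ring
  rw [halfRoot, if_neg one_ne_zero, h, Complex.exp_pi_mul_I]

/-- The entry `-2 cos (π / m)` of the Cartan matrix, with a value less than `-2` if `m = 0`. -/
noncomputable def cartan (i j : B) : ℂ := -(halfRoot (M i j) + (halfRoot (M i j))⁻¹)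

theorem cartan_self (i : B) : M.cartan i i = 2 := by
  rw [cartan, M.diagonal, halfRoot_one]; norm_num

theorem cartan_comm (i j : B) : M.cartan i j = M.cartan j i := by
  rw [cartan, cartan, M.symmetric]

/-- The reflections of the dual of the geometric representation. -/
noncomputable def dualReflection (i : B) : Function.End (B → ℂ) :=
  fun v x => v x - M.cartan i x * v i

theorem dualReflection_mul_apply_add {i j : B} {η : ℂ} (hη : η ≠ 0)
    (h : M.cartan i j = -(η + η⁻¹)) (v : B → ℂ) :
    (M.dualReflection i * M.dualReflection j) v i +
        η * (M.dualReflection i * M.dualReflection j) v j = η ^ 2 * (v i + η * v j) := by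
  change M.dualReflection i (M.dualReflection j v) i +
    η * M.dualReflection i (M.dualReflection j v) j = _
  simp only [dualReflection, cartan_self, M.cartan_comm j i, h]
  field_simp
  ring

theorem dualReflection_mul_pow_apply_add {i j : B} {η : ℂ} (hη : η ≠ 0)
    (h : M.cartan i j = -(η + η⁻¹)) (n : ℕ) (v : B → ℂ) :
    ((M.dualReflection i * M.dualReflection j) ^ n) v i +
        η * ((M.dualReflection i * M.dualReflection j) ^ n) v j =
      (η ^ 2) ^ n * (v i + η * v j) := by
  induction n with
  | zero => simp; rfl
  | succ n ih =>
    rw [pow_succ']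
    have := M.dualReflection_mul_apply_add hη h
      (((M.dualReflection i * M.dualReflection j) ^ n) v)
    rw [ih, ← mul_assoc, ← pow_succ'] at this
    exact this

theorem dualReflection_mul_apply_sub {i j : B} (h : 4 - M.cartan i j ^ 2 ≠ 0) (x : B) :
    ∃ p q : ℂ, ∀ v : B → ℂ,
      (M.dualReflection i * M.dualReflection j) v x -
          p * (M.dualReflection i * M.dualReflection j) v i -
          q * (M.dualReflection i * M.dualReflection j) v j = v x - p * v i - q * v j := by
  refine ⟨(2 * M.cartan i x - M.cartan i j * M.cartan j x) / (4 - M.cartan i j ^ 2),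
    (2 * M.cartan j x - M.cartan i j * M.cartan i x) / (4 - M.cartan i j ^ 2), fun v => ?_⟩
  change M.dualReflection i (M.dualReflection j v) x -
    _ * M.dualReflection i (M.dualReflection j v) i -
    _ * M.dualReflection i (M.dualReflection j v) j = _
  simp only [dualReflection, cartan_self, M.cartan_comm j i]
  field_simp
  ring

theorem isLiftable_dualReflection : M.IsLiftable M.dualReflection := by
  intro i j
  by_cases hij : i = j
  · subst hij
    rw [M.diagonal, pow_one]
    funext v x
    change M.dualReflection i (M.dualReflection i v) x = v x
    simp only [dualReflection, cartan_self]
    ring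
  by_cases hm : M i j = 0
  · rw [hm, pow_zero]
  have hη := halfRoot_ne_zero (M i j)
  have hm1 := M.off_diagonal i j hij
  have hc : M.cartan i j = -(halfRoot (M i j) + (halfRoot (M i j))⁻¹) := rfl
  have hpow := (halfRoot_sq_pow_eq_one_iff (M i j) (M i j)).2 dvd_rfl
  have hsq : halfRoot (M i j) ^ 2 ≠ 1 := by
    intro h
    have := (halfRoot_sq_pow_eq_one_iff (M i j) 1).1 (by rw [pow_one, h])
    exact hm1 (Nat.dvd_one.1 this)
  generalize halfRoot (M i j) = η at *
  have hsub : η - η⁻¹ ≠ 0 := by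
    intro h
    apply hsq
    field_simp at h
    linear_combination h
  have hdet : 4 - M.cartan i j ^ 2 ≠ 0 := by
    have e : 4 - M.cartan i j ^ 2 = -(η - η⁻¹) ^ 2 := by
      rw [hc]; field_simp; ring
    rw [e]
    exact neg_ne_zero.2 (pow_ne_zero 2 hsub)
  funext v x
  have h1 := M.dualReflection_mul_pow_apply_add hη hc (M i j) v
  have h2 := M.dualReflection_mul_pow_apply_add (inv_ne_zero hη)
    (by rw [hc, inv_inv, add_comm]) (M i j) v
  rw [hpow, one_mul] at h1
  rw [inv_pow, inv_pow, hpow, inv_one, one_mul] at h2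
  obtain ⟨p, q, hpq⟩ := M.dualReflection_mul_apply_sub hdet x
  have h3 : ∀ n : ℕ, ((M.dualReflection i * M.dualReflection j) ^ n) v x -
      p * ((M.dualReflection i * M.dualReflection j) ^ n) v i -
      q * ((M.dualReflection i * M.dualReflection j) ^ n) v j = v x - p * v i - q * v j := by
    intro n
    induction n with
    | zero => simp; rfl
    | succ n ih =>
      rw [pow_succ', ← ih]
      exact hpq _
  have h3 := h3 (M i j)
  change ((M.dualReflection i * M.dualReflection j) ^ M i j) v x = v x
  generalize ((M.dualReflection i * M.dualReflection j) ^ M i j) v = u at *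
  have hj : u j = v j := by
    apply mul_left_cancel₀ hsub
    linear_combination h1 - h2
  have hi : u i = v i := by
    rw [hj] at h1
    exact add_right_cancel h1
  rw [hi, hj] at h3
  linear_combination h3

end CoxeterMatrix

namespace CoxeterSystem

variable {B W : Type*} [Group W] {M : CoxeterMatrix B} (cs : CoxeterSystem M W)

theorem dvd_of_simple_mul_simple_pow_eq_one {i j : B} (hij : i ≠ j) {k : ℕ}
    (h : (cs.simple i * cs.simple j) ^ k = 1) : M i j ∣ k := by
  classical
  have h1 := congrArg (cs.lift ⟨_, M.isLiftable_dualReflection⟩) h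
  rw [map_pow, map_mul, cs.lift_apply_simple, cs.lift_apply_simple, map_one] at h1
  have h2 := M.dualReflection_mul_pow_apply_add (CoxeterMatrix.halfRoot_ne_zero (M i j))
    rfl k (Pi.single i 1)
  rw [h1] at h2
  change (Pi.single i 1 : B → ℂ) i + _ * (Pi.single i 1 : B → ℂ) j = _ at h2
  rw [Pi.single_eq_same, Pi.single_eq_of_ne hij.symm] at h2
  rw [← CoxeterMatrix.halfRoot_sq_pow_eq_one_iff]
  simpa using h2.symm

end CoxeterSystem

/-- The alternating word `s, t, s, …` with `n` letters, starting with `s`. -/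
def altWord {B : Type*} (s t : B) : ℕ → List B
  | 0 => []
  | n + 1 => s :: altWord t s n

theorem length_altWord {B : Type*} (s t : B) (n : ℕ) : (altWord s t n).length = n := by
  induction n generalizing s t with
  | zero => rfl
  | succ n ih => simp [altWord, ih]

theorem CoxeterSystem.reverse_alternatingWord {B : Type*} (s t : B) (n : ℕ) :
    (alternatingWord s t n).reverse = altWord t s n := by
  induction n generalizing s t with
  | zero => rfl
  | succ n ih => simp [alternatingWord_succ, altWord, ih]

theorem prod_map_altWord {B N : Type*} [Monoid N] (f : B → N) (s t : B) (n : ℕ) :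
    ((altWord s t n).map f).prod = braidProd f s t n := by
  induction n generalizing s t with
  | zero => rfl
  | succ n ih =>
    rw [altWord, List.map_cons, List.prod_cons, ih, braidProd, braidProd,
      List.range_succ_eq_map, List.map_cons, List.prod_cons, List.map_map]
    congr 2
    refine List.map_congr_left fun i _ => ?_
    rcases Nat.mod_two_eq_zero_or_one i with h | h <;> simp [Nat.add_mod, h]

namespace CoxeterSystem

variable {B W : Type*} [Group W] {M : CoxeterMatrix B} (cs : CoxeterSystem M W)

theorem exists_eq_pow_mul_of_mem_leftInvSeq_altWord {s t : B} {n : ℕ} {r : W}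
    (h : r ∈ cs.leftInvSeq (altWord s t n)) :
    ∃ k < n, r = (cs.simple s * cs.simple t) ^ k * cs.simple s := by
  induction n generalizing s t r with
  | zero => simp [altWord] at h
  | succ n ih =>
    simp only [altWord, leftInvSeq, List.mem_cons, List.mem_map] at h
    rcases h with rfl | ⟨r, hr, rfl⟩
    · exact ⟨0, by omega, by simp⟩
    · obtain ⟨k, hk, rfl⟩ := ih hr
      refine ⟨k + 1, by omega, ?_⟩
      have h : SemiconjBy (cs.simple s) (cs.simple t * cs.simple s)
          (cs.simple s * cs.simple t) := by simp [SemiconjBy, mul_assoc]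
      rw [MulAut.conj_apply, ← mul_assoc, (h.pow_right k).eq, cs.inv_simple, pow_succ]
      simp only [mul_assoc]

/-- If `s` and `t` are left descents of `w`, then `w` has reduced expressions starting with
alternating words in `s` and `t` of any length up to `M s t`. -/
theorem exists_isReduced_altWord_append {w : W} {s t : B} (hst : s ≠ t)
    (hs : cs.IsLeftDescent w s) (ht : cs.IsLeftDescent w t) (n : ℕ)
    (hn : M s t = 0 ∨ n < M s t) :
    ∃ c, cs.IsReduced (altWord s t (n + 1) ++ c) ∧ cs.wordProd (altWord s t (n + 1) ++ c) = w := by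
  induction n generalizing s t with
  | zero => exact cs.exists_isReduced_cons_of_isLeftDescent hs
  | succ n ih =>
    obtain ⟨c, hr, hw⟩ := ih hst.symm ht hs (by rw [M.symmetric t s]; omega)
    have hmem := cs.simple_mem_leftInvSeq (hw ▸ hs)
    rw [leftInvSeq_append, List.mem_append] at hmem
    rcases hmem with hmem | hmem
    · exfalso
      obtain ⟨k, hk, hsk⟩ := cs.exists_eq_pow_mul_of_mem_leftInvSeq_altWord hmem
      have h1 : (cs.simple t * cs.simple s) ^ (k + 1) = 1 := by
        rw [pow_succ, ← mul_assoc, ← hsk, cs.simple_mul_simple_self]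
      have h2 := cs.dvd_of_simple_mul_simple_pow_eq_one hst.symm h1
      rw [M.symmetric t s] at h2
      rcases hn with hn | hn
      · rw [hn, zero_dvd_iff] at h2
        omega
      · have := Nat.le_of_dvd (by omega) h2
        omega
    · obtain ⟨r, hrc, hsr⟩ := List.mem_map.1 hmem
      obtain ⟨c', hlen, hc'⟩ := cs.exists_wordProd_eq_mul_of_mem_leftInvSeq hrc
      have hp : cs.wordProd (altWord s t (n + 1 + 1) ++ c') = w := by
        rw [altWord, List.cons_append, wordProd_cons, wordProd_append, hc', ← hsr, ← hw,
          wordProd_append, MulAut.conj_apply]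
        have hsq := cs.simple_mul_simple_self s
        rw [← hsr, MulAut.conj_apply] at hsq
        generalize cs.wordProd (altWord t s (n + 1)) = g at hsq ⊢
        calc g * r * g⁻¹ * (g * (r * cs.wordProd c))
            = g * r * g⁻¹ * (g * r * g⁻¹) * (g * cs.wordProd c) := by group
          _ = _ := by rw [hsq, one_mul]
      refine ⟨c', ?_, hp⟩
      have hl := hr.eq
      rw [hw] at hl
      rw [IsReduced, hp, hl]
      simp only [List.length_append, length_altWord]
      omega

theorem prod_map_eq_of_wordProd_eq {N : Type*} [Monoid N] (f : B → N)
    (hf : ∀ s t : B, s ≠ t → M s t ≠ 0 → braidProd f s t (M s t) = braidProd f t s (M s t))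
    {ω ω' : List B} (hω : cs.IsReduced ω) (hω' : cs.IsReduced ω')
    (h : cs.wordProd ω = cs.wordProd ω') : (ω.map f).prod = (ω'.map f).prod := by
  induction hn : ω.length generalizing ω ω' with
  | zero =>
    have hl : ω'.length = 0 := by rw [← hω'.eq, ← h, hω.eq, hn]
    rw [List.length_eq_zero_iff.1 hl, List.length_eq_zero_iff.1 hn]
  | succ n ih =>
    have key : ∀ {i : B} {a b : List B}, cs.IsReduced (i :: a) → cs.IsReduced (i :: b) →
        cs.wordProd (i :: a) = cs.wordProd (i :: b) → (i :: a).length = n + 1 →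
        ((i :: a).map f).prod = ((i :: b).map f).prod := by
      intro i a b ha hb hab hla
      have ha' : cs.IsReduced a := ha.drop 1
      have hb' : cs.IsReduced b := hb.drop 1
      rw [List.map_cons, List.map_cons, List.prod_cons, List.prod_cons,
        ih ha' hb' (by simpa [wordProd_cons] using hab) (by simpa using hla)]
    have hl : ω'.length = n + 1 := by rw [← hω'.eq, ← h, hω.eq, hn]
    match ω, ω', hn, hl with
    | s :: a, t :: b, hn, hl =>
      by_cases hst : s = t
      · subst hst
        exact key hω hω' h hn
      have desc : ∀ {i : B} {a : List B}, cs.IsReduced (i :: a) →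
          cs.IsLeftDescent (cs.wordProd (i :: a)) i := by
        intro i a ha
        have ha' : cs.IsReduced a := ha.drop 1
        rw [IsLeftDescent, ha.eq, wordProd_cons, simple_mul_simple_cancel_left, ha'.eq]
        simp
      have hs := desc hω
      have ht : cs.IsLeftDescent (cs.wordProd (s :: a)) t := h ▸ desc hω'
      have hm : M s t ≠ 0 := by
        intro hm
        obtain ⟨c, hr, hw⟩ := cs.exists_isReduced_altWord_append hst hs ht (n + 1) (Or.inl hm)
        have := hr.eq
        rw [hw, hω.eq, hn, List.length_append, length_altWord] at this
        omega
      obtain ⟨m, hm'⟩ := Nat.exists_eq_succ_of_ne_zero hm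
      obtain ⟨c, hr, hw⟩ := cs.exists_isReduced_altWord_append hst hs ht m (by omega)
      have hbraid : cs.wordProd (altWord s t (m + 1)) = cs.wordProd (altWord t s (m + 1)) := by
        rw [← reverse_alternatingWord, ← reverse_alternatingWord, wordProd_reverse,
          wordProd_reverse, ← Nat.succ_eq_add_one, ← hm']
        nth_rw 1 [M.symmetric s t]
        rw [cs.wordProd_braidWord_eq s t]
      have hw' : cs.wordProd (altWord t s (m + 1) ++ c) = cs.wordProd (s :: a) := by
        rw [← hw, wordProd_append, wordProd_append, hbraid]
      have hr' : cs.IsReduced (altWord t s (m + 1) ++ c) := by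
        have := hr.eq
        rw [hw] at this
        rw [IsReduced, hw', this]
        simp [length_altWord]
      have e1 := key hω hr hw.symm hn
      have e2 := key hω' hr' (by rw [← h]; exact hw'.symm) hl
      rw [e1, e2]
      change ((altWord s t (m + 1) ++ c).map f).prod = ((altWord t s (m + 1) ++ c).map f).prod
      have hb := hf s t hst hm
      rw [hm'] at hb
      rw [List.map_append, List.map_append, List.prod_append, List.prod_append,
        prod_map_altWord, prod_map_altWord, hb]

end CoxeterSystem

/-- **Matsumoto's theorem.** If `f : S → M` into a monoid satisfies the braid
relations of a Coxeter system `(W, S)`, then there is a unique map `F : W → M`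
with `F w = f s₁ ⋯ f sₖ` for every reduced expression `w = s₁ ⋯ sₖ`. -/
theorem matsumoto {B W : Type*} [Group W] (M : CoxeterMatrix B)
    (cs : CoxeterSystem M W) {N : Type*} [Monoid N] (f : B → N)
    (hf : ∀ s t : B, s ≠ t → M.M s t ≠ 0 →
      braidProd f s t (M.M s t) = braidProd f t s (M.M s t)) :
    ∃! F : W → N, ∀ l : List B, cs.IsReduced l →
      F (cs.wordProd l) = (l.map f).prod := by
  choose word hword hprod using cs.exists_isReduced
  refine ⟨fun w => ((word w).map f).prod, fun l hl => ?_, fun G hG => ?_⟩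
  · exact cs.prod_map_eq_of_wordProd_eq f hf (hword _) hl (hprod _).symm
  · funext w
    conv_lhs => rw [hprod w]
    exact hG _ (hword w)
end
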